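/- arXiv:2112.06099 — 7 statements merged into one kernel-verified Lean document; each statement's English description precedes it below -/
import Mathlib

section
/- Assume the coupling matrix B = (b_{i,j}) is positive semi-definite, i.e. b_{1,1} x² + (b_{1,2} + b_{2,1}) x y + b_{2,2} y² ≥ 0 for all x, y ∈ ℝ. Let r_1, r_2 ∈ ℕ. For i = 1, 2 let U_i^0, U_i^1, …, U_i^{M_i} ∈ L²(Γ; ℝ) be side values and write U_i^{n−1/2} := (U_i^{n−1} + U_i^n)/2. Let u_{Γ,i} ∈ V(r_i) satisfy ∫_I (u_{Γ,i}(t), λ(t))_Γ dt = Δt_i Σ_{n=1}^{M_i} ( U_i^{n−1/2}, (λ(t_i^{n−1}) + λ(t_i^n))/2 )_Γ for all λ ∈ V(r_i), and let F_i ∈ V(r_i) satisfy ∫_I (F_i(t), λ(t))_Γ dt = ∫_I (b_{i,1} u_{Γ,1}(t) + b_{i,2} u_{Γ,2}(t), λ(t))_Γ dt for all λ ∈ V(r_i). Then the multirate Crank–Nicolson interfacial energy is dissipative: −Σ_{i=1,2} Δt_i Σ_{n=1}^{M_i} ( (F_i(t_i^{n−1}) + F_i(t_i^n))/2, U_i^{n−1/2}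 )_Γ ≤ 0. -/
open MeasureTheory
open scoped RealInnerProductSpace

noncomputable section

/-- The interface `Γ = (0,1)^{d-1} ⊆ ℝ^{d-1}` with Lebesgue measure, encoded as the
restriction of the Lebesgue measure on `ℝ^{d-1}` to the open unit box. -/
def gammaMeasure (d : ℕ) : Measure (Fin (d - 1) → ℝ) :=
  volume.restrict (Set.univ.pi fun _ => Set.Ioo (0 : ℝ) 1)

/-- `V(r)`: functions `ℝ → L²(Γ;ℝ)` of the form `t ↦ ∑_{k=0}^r t^k • w_k` with `w_k ∈ W`. -/
def memV {d : ℕ} (W : Submodule ℝ (Lp ℝ 2 (gammaMeasure d))) (r : ℕ)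
    (f : ℝ → Lp ℝ 2 (gammaMeasure d)) : Prop :=
  ∃ w : Fin (r + 1) → Lp ℝ 2 (gammaMeasure d),
    (∀ k, w k ∈ W) ∧ ∀ t : ℝ, f t = ∑ k : Fin (r + 1), t ^ (k : ℕ) • w k

/-- The `n`-th substep time `t_i^n = α + n Δt_i` with substep size `δ`. -/
def substep (α δ : ℝ) (n : ℕ) : ℝ := α + n * δ

theorem memV.continuous {d : ℕ} {W : Submodule ℝ (Lp ℝ 2 (gammaMeasure d))} {r : ℕ}
    {f : ℝ → Lp ℝ 2 (gammaMeasure d)} (hf : memV W r f) : Continuous f := by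
  obtain ⟨w, -, hw⟩ := hf
  rw [funext hw]
  fun_prop

/-- A positive semi-definite `2 × 2` form stays nonnegative on vectors of an inner product space. -/
theorem inner_coupling_nonneg {E : Type*} [NormedAddCommGroup E] [InnerProductSpace ℝ E]
    {b11 b12 b21 b22 : ℝ}
    (hB : ∀ x y : ℝ, 0 ≤ b11 * x ^ 2 + (b12 + b21) * (x * y) + b22 * y ^ 2) (u v : E) :
    0 ≤ ⟪b11 • u + b12 • v, u⟫ + ⟪b21 • u + b22 • v, v⟫ := by
  simp only [inner_add_left, real_inner_smul_left, real_inner_self_eq_norm_sq]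
  rw [real_inner_comm u v]
  obtain ⟨hl, hu⟩ := abs_le.mp (abs_real_inner_le_norm u v)
  rcases le_total 0 (b12 + b21) with hs | hs
  · linarith [hB ‖u‖ (-‖v‖), mul_le_mul_of_nonneg_left hl hs]
  · linarith [hB ‖u‖ ‖v‖, mul_le_mul_of_nonpos_left hu hs]

/-- Continuous functions are integrable on bounded open intervals. -/
theorem integrableOn_Ioo_of_continuous {f : ℝ → ℝ} (hf : Continuous f) (α β : ℝ) :
    IntegrableOn f (Set.Ioo α β) :=
  (hf.continuousOn.integrableOn_Icc (a := α) (b := β)).mono_set Set.Ioo_subset_Icc_self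

/-- dissipativity of the interfacial energy for the multirate
Crank–Nicolson scheme, for a positive semi-definite coupling matrix `B`.
Here `U_i^{n-1/2} = (U_i^{n-1} + U_i^n)/2` and the trapezoid quadrature is used. -/
theorem multirate_crank_nicolson_interfacial_energy
    (d : ℕ) (hd : 2 ≤ d)
    (W : Submodule ℝ (Lp ℝ 2 (gammaMeasure d))) (hW : FiniteDimensional ℝ W)
    (α β : ℝ) (hαβ : α < β)
    (b11 b12 b21 b22 : ℝ)
    (hB : ∀ x y : ℝ, 0 ≤ b11 * x ^ 2 + (b12 + b21) * (x * y) + b22 * y ^ 2)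
    (M1 M2 : ℕ) (hM1 : 1 ≤ M1) (hM2 : 1 ≤ M2)
    (r1 r2 : ℕ)
    (U1 U2 : ℕ → Lp ℝ 2 (gammaMeasure d))
    (uΓ1 uΓ2 F1 F2 : ℝ → Lp ℝ 2 (gammaMeasure d))
    (huΓ1mem : memV W r1 uΓ1) (huΓ2mem : memV W r2 uΓ2)
    (huΓ1 : ∀ lam, memV W r1 lam →
      ∫ t in Set.Ioo α β, ⟪uΓ1 t, lam t⟫ =
        ((β - α) / M1) * ∑ n ∈ Finset.range M1,
          ⟪(2⁻¹ : ℝ) • (U1 n + U1 (n + 1)),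
            (2⁻¹ : ℝ) • (lam (substep α ((β - α) / M1) n) + lam (substep α ((β - α) / M1) (n + 1)))⟫)
    (huΓ2 : ∀ lam, memV W r2 lam →
      ∫ t in Set.Ioo α β, ⟪uΓ2 t, lam t⟫ =
        ((β - α) / M2) * ∑ n ∈ Finset.range M2,
          ⟪(2⁻¹ : ℝ) • (U2 n + U2 (n + 1)),
            (2⁻¹ : ℝ) • (lam (substep α ((β - α) / M2) n) + lam (substep α ((β - α) / M2) (n + 1)))⟫)
    (hF1mem : memV W r1 F1) (hF2mem : memV W r2 F2)
    (hF1 : ∀ lam, memV W r1 lam →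
      ∫ t in Set.Ioo α β, ⟪F1 t, lam t⟫ =
        ∫ t in Set.Ioo α β, ⟪b11 • uΓ1 t + b12 • uΓ2 t, lam t⟫)
    (hF2 : ∀ lam, memV W r2 lam →
      ∫ t in Set.Ioo α β, ⟪F2 t, lam t⟫ =
        ∫ t in Set.Ioo α β, ⟪b21 • uΓ1 t + b22 • uΓ2 t, lam t⟫) :
    -(((β - α) / M1) * (∑ n ∈ Finset.range M1,
        ⟪(2⁻¹ : ℝ) • (F1 (substep α ((β - α) / M1) n) + F1 (substep α ((β - α) / M1) (n + 1))),
          (2⁻¹ : ℝ) • (U1 n + U1 (n + 1))⟫) +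
      ((β - α) / M2) * (∑ n ∈ Finset.range M2,
        ⟪(2⁻¹ : ℝ) • (F2 (substep α ((β - α) / M2) n) + F2 (substep α ((β - α) / M2) (n + 1))),
          (2⁻¹ : ℝ) • (U2 n + U2 (n + 1))⟫)) ≤ 0 := by
  have hc1 := huΓ1mem.continuous
  have hc2 := huΓ2mem.continuous
  rw [Left.neg_nonpos_iff]
  calc (0 : ℝ) ≤ ∫ t in Set.Ioo α β,
        (⟪b11 • uΓ1 t + b12 • uΓ2 t, uΓ1 t⟫ + ⟪b21 • uΓ1 t + b22 • uΓ2 t, uΓ2 t⟫) :=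
        integral_nonneg fun t => inner_coupling_nonneg hB _ _
    _ = (∫ t in Set.Ioo α β, ⟪F1 t, uΓ1 t⟫) + ∫ t in Set.Ioo α β, ⟪F2 t, uΓ2 t⟫ := by
        rw [hF1 uΓ1 huΓ1mem, hF2 uΓ2 huΓ2mem]
        exact integral_add
          (integrableOn_Ioo_of_continuous (by fun_prop) α β)
          (integrableOn_Ioo_of_continuous (by fun_prop) α β)
    _ = _ := by
        simp_rw [real_inner_comm (uΓ1 _) (F1 _), real_inner_comm (uΓ2 _) (F2 _), huΓ1 F1 hF1mem,
          huΓ2 F2 hF2mem]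
        congr 2 <;> exact Finset.sum_congr rfl fun n _ => real_inner_comm _ _
end
end

section
/- Assume b_{1,1} = −b_{2,1} and b_{1,2} = −b_{2,2}, with vanishing interfacial forcings (g_1 = g_2 = 0). Let r_1, r_2 ∈ {0, 1}. For i = 1, 2 let u_{Γ,i} ∈ V(r_i), and let F_i ∈ V(r_i) satisfy ∫_I (F_i(t), λ(t))_Γ dt = ∫_I (b_{i,1} u_{Γ,1}(t) + b_{i,2} u_{Γ,2}(t), λ(t))_Γ dt for all λ ∈ V(r_i). Then the trapezoidal (Crank–Nicolson) quadrature sums of the discrete fluxes conserve weakly: Σ_{i=1,2} Δt_i Σ_{n=1}^{M_i} ( (F_i(t_i^{n−1}) + F_i(t_i^n))/2, w )_Γ = 0 for every w ∈ W. -/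
open MeasureTheory
open scoped RealInnerProductSpace

noncomputable section

theorem memV.exists_eq_add_smul {d : ℕ} {W : Submodule ℝ (Lp ℝ 2 (gammaMeasure d))} {r : ℕ}
    (hr : r ≤ 1) {f : ℝ → Lp ℝ 2 (gammaMeasure d)} (hf : memV W r f) :
    ∃ a b : Lp ℝ 2 (gammaMeasure d), ∀ t : ℝ, f t = a + t • b := by
  obtain ⟨w, -, hw⟩ := hf
  interval_cases r
  · exact ⟨w 0, 0, fun t => by simp [hw t]⟩
  · exact ⟨w 0, w 1, fun t => by simp [hw t, Fin.sum_univ_two]⟩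

theorem memV_const {d : ℕ} {W : Submodule ℝ (Lp ℝ 2 (gammaMeasure d))} (r : ℕ)
    {w : Lp ℝ 2 (gammaMeasure d)} (hw : w ∈ W) : memV W r fun _ => w := by
  refine ⟨Fin.cons w fun _ => 0, fun k => ?_, fun t => ?_⟩
  · cases k using Fin.cases with
    | zero => exact hw
    | succ k => exact W.zero_mem
  · simp [Fin.sum_univ_succ]

theorem sum_trapezoid_affine (p q α δ : ℝ) (M : ℕ) :
    ∑ n ∈ Finset.range M,
        2⁻¹ * ((p + substep α δ n * q) + (p + substep α δ (n + 1) * q)) =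
      M * p + q * (M * α + δ * M ^ 2 / 2) := by
  induction M with
  | zero => simp
  | succ M ih =>
    rw [Finset.sum_range_succ, ih]
    simp only [substep]
    push_cast
    ring

/-- The composite trapezoidal rule is exact on time-affine functions. -/
theorem trapezoid_eq_integral {d : ℕ} {W : Submodule ℝ (Lp ℝ 2 (gammaMeasure d))} {r : ℕ}
    (hr : r ≤ 1) {f : ℝ → Lp ℝ 2 (gammaMeasure d)} (hf : memV W r f)
    {α β : ℝ} (hαβ : α ≤ β) {M : ℕ} (hM : 1 ≤ M) (w : Lp ℝ 2 (gammaMeasure d)) :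
    ((β - α) / M) * (∑ n ∈ Finset.range M,
        ⟪(2⁻¹ : ℝ) • (f (substep α ((β - α) / M) n) + f (substep α ((β - α) / M) (n + 1))), w⟫) =
      ∫ t in Set.Ioo α β, ⟪f t, w⟫ := by
  obtain ⟨a, b, hab⟩ := hf.exists_eq_add_smul hr
  have hM0 : (M : ℝ) ≠ 0 := by positivity
  rw [← integral_Ioc_eq_integral_Ioo, ← intervalIntegral.integral_of_le hαβ]
  simp only [hab, inner_add_left, real_inner_smul_left]
  rw [sum_trapezoid_affine, intervalIntegral.integral_add (by simp)
    (Continuous.intervalIntegrable (by fun_prop) _ _),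
    intervalIntegral.integral_const, intervalIntegral.integral_mul_const, integral_id]
  simp only [smul_eq_mul]
  field_simp
  ring

/-- flux conservation for the multirate Crank–Nicolson scheme: for
`r_1, r_2 ∈ {0,1}`, antisymmetric coupling coefficients and vanishing interfacial
forcings, the trapezoidal quadrature sums of the discrete fluxes conserve weakly. -/
theorem multirate_crank_nicolson_flux_conservation
    (d : ℕ) (hd : 2 ≤ d)
    (W : Submodule ℝ (Lp ℝ 2 (gammaMeasure d))) (hW : FiniteDimensional ℝ W)
    (α β : ℝ) (hαβ : α < β)
    (b11 b12 b21 b22 : ℝ)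
    (hb1 : b11 = -b21) (hb2 : b12 = -b22)
    (M1 M2 : ℕ) (hM1 : 1 ≤ M1) (hM2 : 1 ≤ M2)
    (r1 r2 : ℕ) (hr1 : r1 ≤ 1) (hr2 : r2 ≤ 1)
    (uΓ1 uΓ2 F1 F2 : ℝ → Lp ℝ 2 (gammaMeasure d))
    (huΓ1mem : memV W r1 uΓ1) (huΓ2mem : memV W r2 uΓ2)
    (hF1mem : memV W r1 F1) (hF2mem : memV W r2 F2)
    (hF1 : ∀ lam, memV W r1 lam →
      ∫ t in Set.Ioo α β, ⟪F1 t, lam t⟫ =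
        ∫ t in Set.Ioo α β, ⟪b11 • uΓ1 t + b12 • uΓ2 t, lam t⟫)
    (hF2 : ∀ lam, memV W r2 lam →
      ∫ t in Set.Ioo α β, ⟪F2 t, lam t⟫ =
        ∫ t in Set.Ioo α β, ⟪b21 • uΓ1 t + b22 • uΓ2 t, lam t⟫) :
    ∀ w ∈ W,
      ((β - α) / M1) * (∑ n ∈ Finset.range M1,
          ⟪(2⁻¹ : ℝ) • (F1 (substep α ((β - α) / M1) n) + F1 (substep α ((β - α) / M1) (n + 1))), w⟫) +
      ((β - α) / M2) * (∑ n ∈ Finset.range M2,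
          ⟪(2⁻¹ : ℝ) • (F2 (substep α ((β - α) / M2) n) + F2 (substep α ((β - α) / M2) (n + 1))), w⟫) = 0 := by
  intro w hw
  rw [trapezoid_eq_integral hr1 hF1mem hαβ.le hM1 w, trapezoid_eq_integral hr2 hF2mem hαβ.le hM2 w,
    hF1 _ (memV_const r1 hw), hF2 _ (memV_const r2 hw), add_eq_zero_iff_eq_neg, ← integral_neg]
  congr 1 with t
  rw [← inner_neg_left, hb1, hb2]
  congr 1
  module
end
end

section
/- Fix reals a < b and define 𝒥 : P_q(E) → P_{q−n_s}(E) × E^{n_s} by 𝒥(v) := ( 𝒫^{q−n_s}_{(a,b)} v , v(a + θ_1 (b−a)), …, v(a + θ_{n_s} (b−a)) ). Then 𝒥 is a linear bijection if and only if the matrix D̃ is invertible. -/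
open MeasureTheory
open scoped RealInnerProductSpace

noncomputable section

/-- `P_m(E)` for `m : ℤ`, `m ≤ q`: E-valued polynomial functions `ℝ → E` of degree at most `m`
(with at most `q+1` coefficients); for `m = -1` this is the zero space. -/
def memPolyZ (E : Type*) [AddCommGroup E] [Module ℝ E] (q : ℕ) (m : ℤ) (f : ℝ → E) : Prop :=
  ∃ c : Fin (q + 1) → E, (∀ k : Fin (q + 1), m < ((k : ℕ) : ℤ) → c k = 0) ∧
    ∀ t : ℝ, f t = ∑ k : Fin (q + 1), t ^ (k : ℕ) • c k

open Polynomial in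
/-- A real polynomial of degree less than `n` is a combination of the first `n` members of a
family of polynomials whose `j`-th member has degree `j`. -/
theorem exists_eq_sum_of_degree_lt {B : ℕ → ℝ[X]} (n : ℕ)
    (hB : ∀ j < n, (B j).degree = (j : ℕ)) (P : ℝ[X]) (hP : P.degree < (n : ℕ)) :
    ∃ α : ℕ → ℝ, P = ∑ j ∈ Finset.range n, C (α j) * B j := by
  induction n generalizing P with
  | zero =>
    refine ⟨0, Polynomial.ext fun k => ?_⟩
    simpa using (degree_lt_iff_coeff_zero P 0).1 hP k k.zero_le
  | succ n ih =>
    have hBn : (B n).natDegree = n := natDegree_eq_of_degree_eq_some (hB n (by omega))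
    have hlead : (B n).coeff n ≠ 0 := by
      have h0 : B n ≠ 0 := by
        intro h
        have := hB n (by omega)
        simp [h] at this
      have := leadingCoeff_ne_zero.mpr h0
      rwa [leadingCoeff, hBn] at this
    set γ : ℝ := P.coeff n / (B n).coeff n with hγ
    have hlt : (P - C γ * B n).degree < (n : ℕ) := by
      rw [degree_lt_iff_coeff_zero]
      intro k hk
      rcases hk.eq_or_lt with rfl | hk
      · simp [hγ, hlead]
      · rw [coeff_sub, coeff_C_mul, coeff_eq_zero_of_natDegree_lt (p := B n) (by omega),
          (degree_lt_iff_coeff_zero P (n + 1)).1 hP k hk]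
        simp
    obtain ⟨α, hα⟩ := ih (fun j hj => hB j (by omega)) _ hlt
    refine ⟨fun j => if j = n then γ else α j, ?_⟩
    rw [Finset.sum_range_succ]
    beta_reduce
    rw [if_pos rfl, ← sub_eq_iff_eq_add, hα]
    refine Finset.sum_congr rfl fun j hj => ?_
    rw [if_neg (Finset.mem_range.1 hj).ne]

open Polynomial in
/-- The `E`-valued polynomial function `∑_{k < n} f_k(t) d_k`. -/
def polyComb {E : Type*} [AddCommGroup E] [Module ℝ E] (f : ℕ → ℝ[X]) (n : ℕ) (d : ℕ → E)
    (t : ℝ) : E :=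
  ∑ k ∈ Finset.range n, (f k).eval t • d k

open Polynomial in
/-- Change of graded basis for `E`-valued polynomial functions, respecting degree bounds. -/
theorem exists_polyComb_eq {E : Type*} [AddCommGroup E] [Module ℝ E] {A B : ℕ → ℝ[X]} {n : ℕ}
    (hA : ∀ j < n, (A j).degree = (j : ℕ)) (hB : ∀ j < n, (B j).degree = (j : ℕ))
    (m : ℤ) (c : ℕ → E) (hc : ∀ k < n, m < (k : ℤ) → c k = 0) :
    ∃ d : ℕ → E, (∀ k : ℕ, m < (k : ℤ) → d k = 0) ∧ polyComb A n c = polyComb B n d := by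
  have hex : ∀ k, ∃ α : ℕ → ℝ, (k < n → A k = ∑ j ∈ Finset.range n, C (α j) * B j) ∧
      ∀ j, k < j → α j = 0 := by
    intro k
    by_cases hk : k < n
    · obtain ⟨α, hα⟩ := exists_eq_sum_of_degree_lt (B := B) (k + 1)
        (fun j hj => hB j (by omega)) (A k) (by rw [hA k hk]; exact_mod_cast k.lt_succ_self)
      refine ⟨fun j => if j < k + 1 then α j else 0, fun _ => ?_, fun j hj => if_neg (by omega)⟩
      rw [hα]
      refine (Finset.sum_congr rfl fun j hj => ?_).trans
        (Finset.sum_subset (Finset.range_subset_range.2 (by omega : k + 1 ≤ n)) fun j _ hj => ?_)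
      · beta_reduce
        rw [if_pos (Finset.mem_range.1 hj)]
      · beta_reduce
        rw [if_neg (mt Finset.mem_range.2 hj), C_0, zero_mul]
    · exact ⟨0, fun h => absurd h hk, fun _ _ => rfl⟩
  choose α hα hα0 using hex
  refine ⟨fun j => ∑ k ∈ Finset.range n, α k j • c k, fun j hj => ?_, ?_⟩
  · refine Finset.sum_eq_zero fun k hk => ?_
    by_cases hkm : m < (k : ℤ)
    · rw [hc k (Finset.mem_range.1 hk) hkm, smul_zero]
    · rw [hα0 k j (by omega), zero_smul]
  · funext t
    simp only [polyComb, Finset.smul_sum]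
    rw [Finset.sum_comm]
    refine Finset.sum_congr rfl fun k hk => ?_
    rw [hα k (Finset.mem_range.1 hk), eval_finsetSum, Finset.sum_smul]
    refine Finset.sum_congr rfl fun j _ => ?_
    rw [eval_mul, eval_C, smul_smul, mul_comm]

open Polynomial in
/-- `memPolyZ` expressed in an arbitrary graded basis of polynomials. -/
theorem memPolyZ_iff_polyComb {E : Type*} [AddCommGroup E] [Module ℝ E] {f : ℕ → ℝ[X]} {q : ℕ}
    (hf : ∀ j < q + 1, (f j).degree = (j : ℕ)) (m : ℤ) (v : ℝ → E) :
    memPolyZ E q m v ↔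
      ∃ d : ℕ → E, (∀ k : ℕ, m < (k : ℤ) → d k = 0) ∧ v = polyComb f (q + 1) d := by
  have hX : ∀ j < q + 1, ((X : ℝ[X]) ^ j).degree = (j : ℕ) := fun j _ => degree_X_pow j
  constructor
  · rintro ⟨c, hc, hv⟩
    obtain ⟨d, hd, h⟩ := exists_polyComb_eq hX hf m
      (fun k => if hk : k < q + 1 then c ⟨k, hk⟩ else 0)
      (fun k hk hmk => by rw [dif_pos hk]; exact hc ⟨k, hk⟩ hmk)
    refine ⟨d, hd, ?_⟩
    rw [← h]
    funext t
    rw [hv t, polyComb, Finset.sum_range]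
    exact Finset.sum_congr rfl fun k _ => by simp only [eval_pow, eval_X, dif_pos k.isLt]
  · rintro ⟨d, hd, rfl⟩
    obtain ⟨c, hc, h⟩ := exists_polyComb_eq hf hX m d fun k _ => hd k
    refine ⟨fun k => c k, fun k hk => hc k hk, fun t => ?_⟩
    rw [h, polyComb, Finset.sum_range]
    simp

open Polynomial in
theorem polyComb_sub {E : Type*} [AddCommGroup E] [Module ℝ E] (f : ℕ → ℝ[X]) (n : ℕ)
    (d e : ℕ → E) (t : ℝ) :
    polyComb f n (d - e) t = polyComb f n d t - polyComb f n e t := by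
  simp [polyComb, smul_sub]

open Polynomial in
theorem integral_sq_pos {p : ℝ[X]} (hp : p ≠ 0) {a b : ℝ} (hab : a < b) :
    0 < ∫ t in Set.Ioo a b, p.eval t * p.eval t := by
  rw [← integral_Ioc_eq_integral_Ioo, ← intervalIntegral.integral_of_le hab.le]
  refine intervalIntegral.integral_pos hab (by fun_prop) (fun t _ => mul_self_nonneg _) ?_
  by_contra! h
  refine hp (p.eq_zero_of_infinite_isRoot ((Set.Icc_infinite hab).mono fun t ht => ?_))
  exact mul_self_eq_zero.1 (le_antisymm (h t ht) (mul_self_nonneg _))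

open Polynomial in
/-- A combination of orthogonal polynomials which is orthogonal to its own `k`-th summand has
vanishing `k`-th coefficient. -/
theorem eq_zero_of_integral_inner_polyComb {E : Type*} [NormedAddCommGroup E]
    [InnerProductSpace ℝ E] {f : ℕ → ℝ[X]} {n : ℕ} {a b : ℝ} (hab : a < b)
    (hf : ∀ j < n, f j ≠ 0)
    (horth : ∀ j < n, ∀ k < n, j ≠ k →
      ∫ t in Set.Ioo a b, (f j).eval t * (f k).eval t = 0)
    (e : ℕ → E) {k : ℕ} (hk : k < n)
    (h : ∫ t in Set.Ioo a b, ⟪polyComb f n e t, (f k).eval t • e k⟫ = 0) : e k = 0 := by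
  have hint : ∀ j, Integrable (fun t => (f j).eval t * (f k).eval t * ⟪e j, e k⟫)
      (volume.restrict (Set.Ioo a b)) := fun j =>
    (Continuous.integrableOn_Icc (by fun_prop)).mono_set Set.Ioo_subset_Icc_self
  have heq : ∀ t, ⟪polyComb f n e t, (f k).eval t • e k⟫ =
      ∑ j ∈ Finset.range n, (f j).eval t * (f k).eval t * ⟪e j, e k⟫ := by
    intro t
    rw [polyComb, sum_inner]
    refine Finset.sum_congr rfl fun j _ => ?_
    rw [real_inner_smul_left, real_inner_smul_right, mul_assoc]
  simp only [heq] at h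
  rw [integral_finsetSum _ fun j _ => hint j, Finset.sum_eq_single_of_mem k
    (Finset.mem_range.2 hk), integral_mul_const] at h
  · rcases mul_eq_zero.1 h with h | h
    · exact absurd h (integral_sq_pos (hf k hk) hab).ne'
    · exact inner_self_eq_zero.1 h
  · intro j hj hjk
    rw [integral_mul_const, horth j (Finset.mem_range.1 hj) k hk hjk, zero_mul]

open Polynomial in
theorem polyComb_injective {E : Type*} [NormedAddCommGroup E]
    [InnerProductSpace ℝ E] {f : ℕ → ℝ[X]} {n : ℕ} {a b : ℝ} (hab : a < b)
    (hf : ∀ j < n, f j ≠ 0)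
    (horth : ∀ j < n, ∀ k < n, j ≠ k →
      ∫ t in Set.Ioo a b, (f j).eval t * (f k).eval t = 0)
    {d e : ℕ → E} (h : polyComb f n d = polyComb f n e) {k : ℕ} (hk : k < n) : d k = e k := by
  refine sub_eq_zero.1 (eq_zero_of_integral_inner_polyComb hab hf horth (d - e) hk ?_)
  simp [polyComb_sub, h]

/-- Matrices with `M * N = 1` act as mutually inverse maps on tuples in a module. -/
theorem sum_smul_sum_smul_of_mul_eq_one {E ι : Type*} [AddCommGroup E] [Module ℝ E] [Fintype ι]
    [DecidableEq ι] {M N : Matrix ι ι ℝ} (h : M * N = 1) (e : ι → E) (i : ι) :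
    ∑ j, M i j • ∑ k, N j k • e k = e i := by
  simp only [Finset.smul_sum, smul_smul]
  rw [Finset.sum_comm]
  simp only [← Finset.sum_smul, ← Matrix.mul_apply, h, Matrix.one_apply, ite_smul, one_smul,
    zero_smul, Finset.sum_ite_eq, Finset.mem_univ, if_true]

open Polynomial in
/-- The affine change of variables from `(a, b)` to `(-1, 1)` preserves orthogonality. -/
theorem integral_comp_affine_eq_zero {p r : ℝ[X]} {a b : ℝ} (hab : a < b)
    (h : ∫ t in (-1 : ℝ)..1, p.eval t * r.eval t = 0) :
    ∫ t in Set.Ioo a b, (p.comp (C (2 / (b - a)) * X + C (-2 * a / (b - a) - 1))).eval t *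
      (r.comp (C (2 / (b - a)) * X + C (-2 * a / (b - a) - 1))).eval t = 0 := by
  have hba : b - a ≠ 0 := (sub_pos.2 hab).ne'
  rw [← integral_Ioc_eq_integral_Ioo, ← intervalIntegral.integral_of_le hab.le]
  simp only [eval_comp, eval_add, eval_mul, eval_C, eval_X]
  rw [intervalIntegral.integral_comp_mul_add (fun s => p.eval s * r.eval s)
    (div_ne_zero two_ne_zero hba)]
  have ha : 2 / (b - a) * a + (-2 * a / (b - a) - 1) = -1 := by field_simp; ring
  have hb : 2 / (b - a) * b + (-2 * a / (b - a) - 1) = 1 := by field_simp; ring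
  rw [ha, hb, h, smul_zero]

open Polynomial in
/-- The orthogonal projection onto lower degree truncates expansions in orthogonal polynomials. -/
theorem projection_polyComb {E : Type*} [NormedAddCommGroup E] [InnerProductSpace ℝ E]
    {f : ℕ → ℝ[X]} {q : ℕ} {m : ℤ} {a b : ℝ} (hab : a < b)
    (hdeg : ∀ j < q + 1, (f j).degree = (j : ℕ)) (hf : ∀ j < q + 1, f j ≠ 0)
    (horth : ∀ j < q + 1, ∀ k < q + 1, j ≠ k →
      ∫ t in Set.Ioo a b, (f j).eval t * (f k).eval t = 0)
    (d : ℕ → E) {u : ℝ → E} (hu : memPolyZ E q m u)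
    (h : ∀ w : ℝ → E, memPolyZ E q m w →
      ∫ t in Set.Ioo a b, ⟪polyComb f (q + 1) d t - u t, w t⟫ = 0) :
    u = polyComb f (q + 1) (fun k => if (k : ℤ) ≤ m then d k else 0) := by
  obtain ⟨p, hp, rfl⟩ := (memPolyZ_iff_polyComb hdeg m u).1 hu
  funext t
  refine Finset.sum_congr rfl fun k hk => ?_
  have hk := Finset.mem_range.1 hk
  congr 1
  beta_reduce
  split_ifs with hkm
  · refine (sub_eq_zero.1 (eq_zero_of_integral_inner_polyComb hab hf horth (d - p) hk ?_)).symm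
    simp only [polyComb_sub]
    refine h _ ((memPolyZ_iff_polyComb hdeg m _).2
      ⟨Pi.single k ((d - p) k), fun j hj => Pi.single_eq_of_ne (by omega) _, ?_⟩)
    funext t
    rw [polyComb, Finset.sum_eq_single_of_mem k (Finset.mem_range.2 hk), Pi.single_eq_same]
    intro j _ hj
    rw [Pi.single_eq_of_ne hj, smul_zero]
  · exact hp k (by omega)

/-- the map `𝒥(v) = (𝒫^{q-n_s}_{(a,b)} v, v(a+θ₁(b-a)), …, v(a+θ_{n_s}(b-a)))`
from `P_q(E)` to `P_{q-n_s}(E) × E^{n_s}` is a (linear) bijection iff the matrix `D̃` with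
entries `D̃_{j,k} = ψ_{k+q-n_s}(2θ_j - 1)` is invertible. -/
theorem dgit_side_condition_bijection
    (E : Type*) [NormedAddCommGroup E] [InnerProductSpace ℝ E]
    [FiniteDimensional ℝ E] [Nontrivial E]
    (q ns : ℕ) (hns1 : 1 ≤ ns) (hnsq : ns ≤ q + 1)
    (θ : Fin ns → ℝ) (hθ : StrictMono θ) (hθ1 : ∀ k, θ k ≤ 1)
    (ψ : ℕ → Polynomial ℝ)
    (hψdeg : ∀ j ≤ q, (ψ j).degree = (j : ℕ))
    (hψorth : ∀ j ≤ q, ∀ k ≤ q, j ≠ k →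
      ∫ t in (-1 : ℝ)..1, (ψ j).eval t * (ψ k).eval t = 0)
    (a b : ℝ) (hab : a < b)
    -- `Pp` acts as the `L²((a,b);E)`-orthogonal projection onto `P_{q-n_s}(E)`:
    (Pp : (ℝ → E) → (ℝ → E))
    (hPp : ∀ v : ℝ → E, memPolyZ E q (q : ℤ) v →
      memPolyZ E q ((q : ℤ) - ns) (Pp v) ∧
      ∀ w : ℝ → E, memPolyZ E q ((q : ℤ) - ns) w →
        ∫ t in Set.Ioo a b, ⟪v t - Pp v t, w t⟫ = 0) :
    Function.Bijective
      (fun v : {f : ℝ → E // memPolyZ E q (q : ℤ) f} =>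
        ((⟨Pp v.1, (hPp v.1 v.2).1⟩ : {f : ℝ → E // memPolyZ E q ((q : ℤ) - ns) f}),
          fun k : Fin ns => v.1 (a + θ k * (b - a)))) ↔
      IsUnit (Matrix.of fun j k : Fin ns => (ψ (q + 1 - ns + (k : ℕ))).eval (2 * θ j - 1)) := by
  classical
  obtain ⟨r, hr⟩ : ∃ r, q + 1 = r + ns := ⟨q + 1 - ns, by omega⟩
  have hrq : q + 1 - ns = r := by omega
  have hba : b - a ≠ 0 := (sub_pos.2 hab).ne'
  set f : ℕ → Polynomial ℝ := fun j => (ψ j).comp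
    (.C (2 / (b - a)) * .X + .C (-2 * a / (b - a) - 1)) with hfdef
  have hdeg : ∀ j < q + 1, (f j).degree = (j : ℕ) := by
    intro j hj
    have h0 : ψ j ≠ 0 := by
      intro h
      have := hψdeg j (by omega)
      simp [h] at this
    have hlin := Polynomial.natDegree_linear (b := -2 * a / (b - a) - 1)
      (div_ne_zero (two_ne_zero (α := ℝ)) hba)
    rw [hfdef, Polynomial.degree_eq_iff_natDegree_eq, Polynomial.natDegree_comp, hlin, mul_one]
    · exact Polynomial.natDegree_eq_of_degree_eq_some (hψdeg j (by omega))
    · intro h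
      rcases Polynomial.comp_eq_zero_iff.1 h with h | ⟨_, h⟩
      · exact h0 h
      · rw [h, Polynomial.natDegree_C] at hlin
        omega
  have hf : ∀ j < q + 1, f j ≠ 0 := by
    intro j hj h
    have := hdeg j hj
    simp [h] at this
  have horth : ∀ j < q + 1, ∀ k < q + 1, j ≠ k →
      ∫ t in Set.Ioo a b, (f j).eval t * (f k).eval t = 0 := fun j hj k hk hjk =>
    integral_comp_affine_eq_zero hab (hψorth j (by omega) k (by omega) hjk)
  have hmem : ∀ d : ℕ → E, memPolyZ E q q (polyComb f (q + 1) d) := by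
    intro d
    refine (memPolyZ_iff_polyComb hdeg q _).2 ⟨fun k => if k < q + 1 then d k else 0,
      fun k hk => if_neg (by omega), ?_⟩
    funext t
    exact Finset.sum_congr rfl fun k hk => by
      beta_reduce
      rw [if_pos (Finset.mem_range.1 hk)]
  have hproj : ∀ d : ℕ → E, Pp (polyComb f (q + 1) d) =
      polyComb f (q + 1) (fun k => if (k : ℤ) ≤ (q : ℤ) - ns then d k else 0) := fun d =>
    projection_polyComb hab hdeg hf horth d (hPp _ (hmem d)).1 (hPp _ (hmem d)).2
  rw [hrq]
  set M : Matrix (Fin ns) (Fin ns) ℝ :=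
    Matrix.of fun j k : Fin ns => (ψ (r + (k : ℕ))).eval (2 * θ j - 1) with hM
  have hval : ∀ (d : ℕ → E) (j : Fin ns), polyComb f (q + 1) d (a + θ j * (b - a)) =
      polyComb f r d (a + θ j * (b - a)) + ∑ k : Fin ns, M j k • d (r + k) := by
    intro d j
    rw [polyComb, hr, Finset.sum_range_add, Finset.sum_range (n := ns)]
    congr 1
    refine Finset.sum_congr rfl fun k _ => ?_
    rw [hM, Matrix.of_apply, hfdef]
    simp only [Polynomial.eval_comp, Polynomial.eval_add, Polynomial.eval_mul, Polynomial.eval_C,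
      Polynomial.eval_X]
    congr 2
    field_simp
    ring
  constructor
  · intro hbij
    by_contra hunit
    rw [Matrix.isUnit_iff_isUnit_det, isUnit_iff_ne_zero, not_not] at hunit
    obtain ⟨c, hc0, hc⟩ := Matrix.exists_mulVec_eq_zero_iff.2 hunit
    obtain ⟨x, hx⟩ := exists_ne (0 : E)
    set d : ℕ → E := fun k => if h : r ≤ k ∧ k - r < ns then c ⟨k - r, h.2⟩ • x else 0 with hd
    have hdk : ∀ k : Fin ns, d (r + k) = c k • x := by
      intro k
      simp [hd]
    have hdlow : ∀ k < r, d k = 0 := fun k hk => dif_neg (by omega)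
    have hzero : (fun k : ℕ => if (k : ℤ) ≤ (q : ℤ) - ns then d k else 0) =
        fun k : ℕ => if (k : ℤ) ≤ (q : ℤ) - ns then (0 : ℕ → E) k else 0 := by
      funext k
      split_ifs with hk
      · exact hdlow k (by omega)
      · rfl
    have heq : (⟨_, hmem d⟩ : {g : ℝ → E // memPolyZ E q (q : ℤ) g}) = ⟨_, hmem 0⟩ := by
      refine hbij.injective (Prod.ext (Subtype.ext ?_) (funext fun j => ?_))
      · simp only [hproj, hzero]
      · simp only [hval, hdk, smul_smul, ← Finset.sum_smul]
        have hcj : ∑ k, M j k * c k = 0 := congrFun hc j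
        rw [hcj]
        simp only [polyComb, Pi.zero_apply, smul_zero, Finset.sum_const_zero, zero_smul, add_zero]
        refine Finset.sum_eq_zero fun k hk => ?_
        rw [hdlow k (Finset.mem_range.1 hk), smul_zero]
    refine hc0 (funext fun k => ?_)
    have := polyComb_injective hab hf horth (congrArg Subtype.val heq)
      (k := r + k) (by omega)
    rw [hdk, Pi.zero_apply] at this
    exact (smul_eq_zero.1 this).resolve_right hx
  · intro hunit
    have hdet := (Matrix.isUnit_iff_isUnit_det M).1 hunit
    refine ⟨?_, ?_⟩
    · rintro ⟨v, hv⟩ ⟨w, hw⟩ h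
      obtain ⟨d, -, rfl⟩ := (memPolyZ_iff_polyComb hdeg _ v).1 hv
      obtain ⟨e, -, rfl⟩ := (memPolyZ_iff_polyComb hdeg _ w).1 hw
      have h1 : Pp (polyComb f (q + 1) d) = Pp (polyComb f (q + 1) e) :=
        congrArg (fun z => z.1.1) h
      have hlow : ∀ k < r, d k = e k := by
        intro k hk
        rw [hproj, hproj] at h1
        have := polyComb_injective hab hf horth h1 (k := k) (by omega)
        rwa [if_pos (by omega), if_pos (by omega)] at this
      have hsum : ∀ j, ∑ k : Fin ns, M j k • d (r + k) = ∑ k : Fin ns, M j k • e (r + k) := by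
        intro j
        have h2 : polyComb f (q + 1) d (a + θ j * (b - a)) =
            polyComb f (q + 1) e (a + θ j * (b - a)) := congrFun (congrArg Prod.snd h) j
        rw [hval, hval] at h2
        have h3 : polyComb f r d (a + θ j * (b - a)) = polyComb f r e (a + θ j * (b - a)) :=
          Finset.sum_congr rfl fun k hk => by rw [hlow k (Finset.mem_range.1 hk)]
        rwa [h3, add_right_inj] at h2
      have hhigh : ∀ k : Fin ns, d (r + k) = e (r + k) := by
        intro k
        have hMM := M.nonsing_inv_mul hdet
        rw [← sum_smul_sum_smul_of_mul_eq_one hMM (fun k : Fin ns => d (r + k)) k,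
          ← sum_smul_sum_smul_of_mul_eq_one hMM (fun k : Fin ns => e (r + k)) k]
        simp only [hsum]
      refine Subtype.ext (funext fun t => ?_)
      change polyComb f (q + 1) d t = polyComb f (q + 1) e t
      refine Finset.sum_congr rfl fun k hk => ?_
      have hk := Finset.mem_range.1 hk
      rcases lt_or_ge k r with hkr | hkr
      · rw [hlow k hkr]
      · obtain ⟨i, rfl⟩ := Nat.exists_eq_add_of_le hkr
        rw [hhigh ⟨i, by omega⟩]
    · rintro ⟨⟨u, hu⟩, y⟩
      obtain ⟨p, hp, rfl⟩ := (memPolyZ_iff_polyComb hdeg _ u).1 hu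
      set z : Fin ns → E := fun k => ∑ j, M⁻¹ k j • (y j - polyComb f r p (a + θ j * (b - a)))
        with hz
      set d : ℕ → E := fun k => if k < r then p k else
        if h : k - r < ns then z ⟨k - r, h⟩ else 0 with hd
      have hdk : ∀ k : Fin ns, d (r + k) = z k := by
        intro k
        simp [hd]
      have hdlow : ∀ k < r, d k = p k := fun k hk => if_pos hk
      refine ⟨⟨_, hmem d⟩, Prod.ext (Subtype.ext ?_) (funext fun j => ?_)⟩
      · simp only [hproj]
        congr 1
        funext k
        split_ifs with hk
        · exact hdlow k (by omega)
        · exact (hp k (by omega)).symm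
      · simp only [hval, hdk]
        have h3 : polyComb f r d (a + θ j * (b - a)) = polyComb f r p (a + θ j * (b - a)) :=
          Finset.sum_congr rfl fun k hk => by rw [hdlow k (Finset.mem_range.1 hk)]
        rw [h3, hz, sum_smul_sum_smul_of_mul_eq_one (M.mul_nonsing_inv hdet), add_sub_cancel]
end
end

section
/- Assume the matrix D̃ is invertible. Then there exist constants C_1 > 0 and C_2 > 0, depending only on q, n_s and θ_1, …, θ_{n_s} (in particular independent of a, b, the space E and its dimension, and of v), such that for every nontrivial finite-dimensional real inner product space E, all reals a < b, and every v ∈ P_q(E): C_1 ‖v‖_{L²((a,b);E)} ≤ ⫴𝒥(v)⫴ ≤ C_2 ‖v‖_{L²((a,b);E)}, where ⫴𝒥(v)⫴ := sqrt( ‖𝒫^{q−n_s}_{(a,b)} v‖²_{L²((a,b);E)} + (b−a) Σ_{k=1}^{n_s} ‖v(a + θ_k (b−a))‖²_E ). -/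
open MeasureTheory
open scoped RealInnerProductSpace

noncomputable section

open Polynomial in
/-- A family of polynomials with `deg ψ_j = j` expands every polynomial of degree `< n`. -/
theorem exists_eq_sum_C_mul_of_degree_lt {ψ : ℕ → Polynomial ℝ} (n : ℕ)
    (hψ : ∀ j < n, (ψ j).degree = (j : ℕ)) (p : Polynomial ℝ) (hp : p.degree < (n : ℕ)) :
    ∃ c : ℕ → ℝ, p = ∑ j ∈ Finset.range n, C (c j) * ψ j := by
  induction n generalizing p with
  | zero =>
    refine ⟨0, ?_⟩
    simpa [Nat.WithBot.lt_zero_iff] using hp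
  | succ n ih =>
    have hn : (ψ n).degree = (n : ℕ) := hψ n n.lt_succ_self
    have hlc : (ψ n).coeff n ≠ 0 := coeff_ne_zero_of_eq_degree hn
    set r : ℝ := p.coeff n / (ψ n).coeff n with hr
    have hlt : (p - C r * ψ n).degree < (n : ℕ) := by
      rw [degree_lt_iff_coeff_zero]
      intro k hk
      rcases hk.eq_or_lt with rfl | hk
      · simp [hr, hlc]
      · have h1 : p.coeff k = 0 :=
          coeff_eq_zero_of_degree_lt (hp.trans_le (by exact_mod_cast hk))
        have h2 : (ψ n).coeff k = 0 :=
          coeff_eq_zero_of_degree_lt (hn.trans_lt (by exact_mod_cast hk))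
        simp [h1, h2]
    obtain ⟨c, hc⟩ := ih (fun j hj => hψ j (hj.trans n.lt_succ_self)) _ hlt
    refine ⟨Function.update c n r, ?_⟩
    rw [Finset.sum_range_succ, Function.update_self, ← sub_eq_iff_eq_add, hc]
    refine Finset.sum_congr rfl fun j hj => ?_
    rw [Function.update_of_ne (Finset.mem_range.1 hj).ne]

/-- Expansion of an `E`-valued polynomial in a graded scalar family after an affine change of
variables. -/
theorem memPolyZ.exists_sum_eval_smul {E : Type*} [AddCommGroup E] [Module ℝ E] {q n : ℕ}
    (hn : n ≤ q + 1) {ψ : ℕ → Polynomial ℝ} (hψ : ∀ j ≤ q, (ψ j).degree = (j : ℕ))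
    {v : ℝ → E} (hv : memPolyZ E q ((n : ℤ) - 1) v) (α β : ℝ) :
    ∃ d : ℕ → E, (∀ j, n ≤ j → d j = 0) ∧
      ∀ t, v (α * t + β) = ∑ j ∈ Finset.range (q + 1), (ψ j).eval t • d j := by
  obtain ⟨c, hc0, hc⟩ := hv
  have key : ∀ k : ℕ, k < n → ∃ g : ℕ → ℝ, (Polynomial.C α * Polynomial.X + Polynomial.C β) ^ k =
      ∑ j ∈ Finset.range n, Polynomial.C (g j) * ψ j := by
    intro k hk
    refine exists_eq_sum_C_mul_of_degree_lt n (fun j hj => hψ j (by omega)) _ ?_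
    calc ((Polynomial.C α * Polynomial.X + Polynomial.C β) ^ k).degree
        ≤ k • (Polynomial.C α * Polynomial.X + Polynomial.C β).degree := Polynomial.degree_pow_le _ _
      _ ≤ k • (1 : WithBot ℕ) := nsmul_le_nsmul_right Polynomial.degree_linear_le k
      _ < (n : ℕ) := by rw [nsmul_one]; exact_mod_cast hk
  choose! g hg using key
  refine ⟨fun j => if j < n then ∑ k : Fin (q + 1), g k j • c k else 0,
    fun j hj => if_neg hj.not_gt, fun t => ?_⟩
  have hpow : ∀ k : Fin (q + 1), (α * t + β) ^ (k : ℕ) • c k =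
      ∑ j ∈ Finset.range n, (ψ j).eval t • g k j • c k := by
    intro k
    by_cases hk : (k : ℕ) < n
    · have := congrArg (Polynomial.eval t) (hg k hk)
      simp only [Polynomial.eval_pow, Polynomial.eval_add, Polynomial.eval_mul, Polynomial.eval_C,
        Polynomial.eval_X, Polynomial.eval_finsetSum] at this
      rw [this, Finset.sum_smul]
      exact Finset.sum_congr rfl fun j _ => by rw [smul_smul, mul_comm]
    · simp [hc0 k (by omega)]
  rw [hc, Finset.sum_congr rfl fun k _ => hpow k, Finset.sum_comm]
  rw [← Finset.sum_subset (Finset.range_subset_range.2 hn)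
    fun j _ hj => by simp only [if_neg (mt Finset.mem_range.2 hj), smul_zero]]
  refine Finset.sum_congr rfl fun j hj => ?_
  simp only [if_pos (Finset.mem_range.1 hj), Finset.smul_sum]

/-- Combinations of scalar polynomials of degree `< n` with vector coefficients lie in
`P_{n-1}(E)`. -/
theorem memPolyZ_sum_eval_smul {E : Type*} [AddCommGroup E] [Module ℝ E] {q n : ℕ}
    (hn : n ≤ q + 1) (s : Finset ℕ) (p : ℕ → Polynomial ℝ) (d : ℕ → E)
    (hp : ∀ j ∈ s, d j ≠ 0 → (p j).degree < (n : ℕ)) :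
    memPolyZ E q ((n : ℤ) - 1) fun t => ∑ j ∈ s, (p j).eval t • d j := by
  refine ⟨fun k => ∑ j ∈ s, (p j).coeff k • d j, fun k hk => ?_, fun t => ?_⟩
  · refine Finset.sum_eq_zero fun j hj => ?_
    by_cases hd : d j = 0
    · simp [hd]
    · rw [Polynomial.coeff_eq_zero_of_degree_lt, zero_smul]
      exact (hp j hj hd).trans_le (by exact_mod_cast (by omega : n ≤ (k : ℕ)))
  · simp only [Finset.smul_sum]
    rw [Finset.sum_comm]
    refine Finset.sum_congr rfl fun j hj => ?_
    by_cases hd : d j = 0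
    · simp [hd]
    · have hlt : (p j).degree < ((q + 1 : ℕ) : WithBot ℕ) :=
        (hp j hj hd).trans_le (by exact_mod_cast hn)
      have hlt' : (p j).natDegree < q + 1 := by
        by_cases h0 : p j = 0
        · simp [h0]
        · exact (Polynomial.natDegree_lt_iff_degree_lt h0).2 hlt
      rw [Polynomial.eval_eq_sum_range' hlt', Finset.sum_smul, Finset.sum_range]
      exact Finset.sum_congr rfl fun k _ => by rw [smul_smul, mul_comm]

/-- Parseval identity for vector-valued expansions in an orthogonal polynomial family. -/
theorem integral_inner_sum_eval_smul {E : Type*} [NormedAddCommGroup E] [InnerProductSpace ℝ E]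
    {q : ℕ} {ψ : ℕ → Polynomial ℝ}
    (hψ : ∀ j ≤ q, ∀ k ≤ q, j ≠ k → ∫ t in (-1 : ℝ)..1, (ψ j).eval t * (ψ k).eval t = 0)
    (d e : ℕ → E) :
    ∫ t in (-1 : ℝ)..1, ⟪∑ j ∈ Finset.range (q + 1), (ψ j).eval t • d j,
        ∑ j ∈ Finset.range (q + 1), (ψ j).eval t • e j⟫ =
      ∑ j ∈ Finset.range (q + 1), (∫ t in (-1 : ℝ)..1, (ψ j).eval t ^ 2) * ⟪d j, e j⟫ := by
  have hint : ∀ j k, IntervalIntegrable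
      (fun t => (ψ j).eval t * (ψ k).eval t * ⟪d j, e k⟫) volume (-1) 1 := fun j k =>
    Continuous.intervalIntegrable (by fun_prop) _ _
  have hexp : ∀ t, ⟪∑ j ∈ Finset.range (q + 1), (ψ j).eval t • d j,
        ∑ j ∈ Finset.range (q + 1), (ψ j).eval t • e j⟫ =
      ∑ j ∈ Finset.range (q + 1), ∑ k ∈ Finset.range (q + 1),
        (ψ j).eval t * (ψ k).eval t * ⟪d j, e k⟫ := by
    intro t
    simp only [sum_inner, inner_sum, real_inner_smul_left, real_inner_smul_right]
    rw [Finset.sum_comm]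
    exact Finset.sum_congr rfl fun j _ => Finset.sum_congr rfl fun k _ => by ring
  simp only [hexp]
  rw [intervalIntegral.integral_finsetSum fun j _ => Continuous.intervalIntegrable (by fun_prop) _ _]
  refine Finset.sum_congr rfl fun j hj => ?_
  rw [intervalIntegral.integral_finsetSum fun k _ => hint j k, Finset.sum_eq_single_of_mem j hj]
  · simp only [intervalIntegral.integral_mul_const, sq]
  · intro k hk hkj
    rw [intervalIntegral.integral_mul_const, hψ j (by simp at hj; omega) k (by simp at hk; omega)
      hkj.symm, zero_mul]

/-- The square integral over `[-1, 1]` of a nonzero polynomial is positive. -/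
theorem Polynomial.integral_eval_sq_pos {p : Polynomial ℝ} (hp : p ≠ 0) :
    0 < ∫ t in (-1 : ℝ)..1, p.eval t ^ 2 := by
  obtain ⟨t, ht, hpt⟩ : ∃ t ∈ Set.Icc (-1 : ℝ) 1, p.eval t ≠ 0 := by
    by_contra! h
    exact hp (p.eq_zero_of_infinite_isRoot ((Set.Icc_infinite (by norm_num)).mono h))
  exact intervalIntegral.integral_pos (by norm_num) (by fun_prop) (fun _ _ => sq_nonneg _)
    ⟨t, ht, by positivity⟩

/-- Affine change of variables from `(a, b)` to the reference interval `(-1, 1)`. -/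
theorem integral_Ioo_eq_integral_reference {a b : ℝ} (hab : a < b) (f : ℝ → ℝ) :
    ∫ t in Set.Ioo a b, f t =
      (b - a) / 2 * ∫ t in (-1 : ℝ)..1, f ((b - a) / 2 * t + (a + b) / 2) := by
  have h : (b - a) / 2 ≠ 0 := (half_pos (sub_pos.2 hab)).ne'
  rw [← integral_Ioc_eq_integral_Ioo, ← intervalIntegral.integral_of_le hab.le,
    intervalIntegral.integral_comp_mul_add _ h, smul_eq_mul, mul_inv_cancel_left₀ h]
  congr 1 <;> ring

/-- Frobenius bound for a scalar matrix acting on vectors with entries in a normed space. -/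
theorem sum_norm_sq_sum_smul_le {E ι κ : Type*} [SeminormedAddCommGroup E] [NormedSpace ℝ E]
    (s : Finset ι) (t : Finset κ) (A : ι → κ → ℝ) (x : κ → E) :
    ∑ i ∈ s, ‖∑ j ∈ t, A i j • x j‖ ^ 2 ≤ (∑ i ∈ s, ∑ j ∈ t, A i j ^ 2) * ∑ j ∈ t, ‖x j‖ ^ 2 := by
  rw [Finset.sum_mul]
  refine Finset.sum_le_sum fun i _ => ?_
  calc ‖∑ j ∈ t, A i j • x j‖ ^ 2 ≤ (∑ j ∈ t, |A i j| * ‖x j‖) ^ 2 := by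
        gcongr
        exact (norm_sum_le _ _).trans_eq (Finset.sum_congr rfl fun j _ => by
          rw [norm_smul, Real.norm_eq_abs])
    _ ≤ (∑ j ∈ t, |A i j| ^ 2) * ∑ j ∈ t, ‖x j‖ ^ 2 := Finset.sum_mul_sq_le_sq_mul_sq _ _ _
    _ = _ := by simp only [sq_abs]

/-- If the last block of `A` is invertible, the last coefficients are controlled by the first ones
and by the image under `A`. -/
theorem exists_sum_norm_sq_high_le {n m : ℕ} (A : Fin m → ℕ → ℝ)
    (hA : IsUnit (Matrix.of fun j k : Fin m => A j (n + (k : ℕ)))) :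
    ∃ K : ℝ, 0 ≤ K ∧ ∀ (E : Type) [NormedAddCommGroup E] [NormedSpace ℝ E] (d : ℕ → E),
      ∑ i : Fin m, ‖d (n + (i : ℕ))‖ ^ 2 ≤
        K * (∑ j ∈ Finset.range n, ‖d j‖ ^ 2 +
          ∑ k : Fin m, ‖∑ j ∈ Finset.range (n + m), A k j • d j‖ ^ 2) := by
  set D : Matrix (Fin m) (Fin m) ℝ := Matrix.of fun j k : Fin m => A j (n + (k : ℕ)) with hD
  have hinv : D⁻¹ * D = 1 := Matrix.nonsing_inv_mul _ ((Matrix.isUnit_iff_isUnit_det _).1 hA)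
  set KB : ℝ := ∑ i, ∑ j, D⁻¹ i j ^ 2 with hKB
  set KA : ℝ := ∑ k : Fin m, ∑ j ∈ Finset.range n, A k j ^ 2 with hKA
  have hKB0 : 0 ≤ KB := by positivity
  have hKA0 : 0 ≤ KA := by positivity
  refine ⟨KB * (2 * (1 + KA)), by positivity, fun E _ _ d => ?_⟩
  set val : Fin m → E := fun k => ∑ j ∈ Finset.range (n + m), A k j • d j with hval
  set low : Fin m → E := fun k => ∑ j ∈ Finset.range n, A k j • d j with hlow
  have hsub : ∀ k, val k - low k = ∑ i : Fin m, D k i • d (n + (i : ℕ)) := by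
    intro k
    simp only [hval, hlow, Finset.sum_range_add, add_sub_cancel_left]
    rw [Finset.sum_range]
    rfl
  have hd : ∀ i : Fin m, d (n + (i : ℕ)) = ∑ k, D⁻¹ i k • (val k - low k) := by
    intro i
    simp only [hsub, Finset.smul_sum, smul_smul]
    rw [Finset.sum_comm]
    simp only [← Finset.sum_smul, ← Matrix.mul_apply, hinv, Matrix.one_apply, ite_smul, one_smul,
      zero_smul, Finset.sum_ite_eq, Finset.mem_univ, if_true]
  have h1 : ∑ i : Fin m, ‖d (n + (i : ℕ))‖ ^ 2 ≤ KB * ∑ k, ‖val k - low k‖ ^ 2 := by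
    simp only [hd]
    exact sum_norm_sq_sum_smul_le _ _ _ _
  have h2 : ∑ k, ‖val k - low k‖ ^ 2 ≤ 2 * (∑ k, ‖val k‖ ^ 2 + ∑ k, ‖low k‖ ^ 2) := by
    rw [← Finset.sum_add_distrib, Finset.mul_sum]
    refine Finset.sum_le_sum fun k _ => ?_
    have := norm_sub_le (val k) (low k)
    calc ‖val k - low k‖ ^ 2 ≤ (‖val k‖ + ‖low k‖) ^ 2 := by gcongr
      _ ≤ _ := add_sq_le
  have h3 : ∑ k, ‖low k‖ ^ 2 ≤ KA * ∑ j ∈ Finset.range n, ‖d j‖ ^ 2 :=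
    sum_norm_sq_sum_smul_le _ _ _ _
  have hV : 0 ≤ ∑ k, ‖val k‖ ^ 2 := by positivity
  have hS : 0 ≤ ∑ j ∈ Finset.range n, ‖d j‖ ^ 2 := by positivity
  refine h1.trans ?_
  rw [mul_assoc]
  refine mul_le_mul_of_nonneg_left ?_ hKB0
  nlinarith [mul_nonneg hKA0 hV]

/-- Equivalence of the quadratic forms of the expansion coefficients. -/
theorem exists_coeff_quadratic_form_equiv {n m : ℕ} (A : Fin m → ℕ → ℝ)
    (hA : IsUnit (Matrix.of fun j k : Fin m => A j (n + (k : ℕ))))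
    (N : ℕ → ℝ) (hN : ∀ j < n + m, 0 < N j) :
    ∃ K1 K2 : ℝ, 0 < K1 ∧ 0 < K2 ∧
      ∀ (E : Type) [NormedAddCommGroup E] [NormedSpace ℝ E] (d : ℕ → E),
        ∑ j ∈ Finset.range (n + m), N j * ‖d j‖ ^ 2 ≤
          K1 * (∑ j ∈ Finset.range n, N j * ‖d j‖ ^ 2 +
            2 * ∑ k : Fin m, ‖∑ j ∈ Finset.range (n + m), A k j • d j‖ ^ 2) ∧
        ∑ j ∈ Finset.range n, N j * ‖d j‖ ^ 2 +
            2 * ∑ k : Fin m, ‖∑ j ∈ Finset.range (n + m), A k j • d j‖ ^ 2 ≤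
          K2 * ∑ j ∈ Finset.range (n + m), N j * ‖d j‖ ^ 2 := by
  obtain ⟨K, hK, hhigh⟩ := exists_sum_norm_sq_high_le A hA
  have hN' : ∀ j ∈ Finset.range (n + m), 0 < N j := fun j hj => hN j (Finset.mem_range.1 hj)
  set M : ℝ := ∑ j ∈ Finset.range (n + m), N j + 1 with hM
  set R : ℝ := ∑ j ∈ Finset.range (n + m), (N j)⁻¹ with hR
  set F : ℝ := ∑ k : Fin m, ∑ j ∈ Finset.range (n + m), A k j ^ 2 with hF
  have hM0 : 0 < M := add_pos_of_nonneg_of_pos (Finset.sum_nonneg fun j hj => (hN' j hj).le) one_pos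
  have hR0 : 0 ≤ R := Finset.sum_nonneg fun j hj => (inv_pos.2 (hN' j hj)).le
  have hF0 : 0 ≤ F := by positivity
  have hNM : ∀ j ∈ Finset.range (n + m), N j ≤ M := fun j hj =>
    (Finset.single_le_sum (fun i hi => (hN' i hi).le) hj).trans (by simp [hM])
  have hNR : ∀ j ∈ Finset.range (n + m), 1 ≤ R * N j := fun j hj => by
    have : (N j)⁻¹ ≤ R :=
      Finset.single_le_sum (f := fun j => (N j)⁻¹) (fun i hi => (inv_pos.2 (hN' i hi)).le) hj
    simpa [(hN' j hj).ne'] using mul_le_mul_of_nonneg_right this (hN' j hj).le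
  have hsub : Finset.range n ⊆ Finset.range (n + m) :=
    Finset.range_subset_range.2 (Nat.le_add_right n m)
  refine ⟨M * ((1 + K) * R + K + 1), 1 + 2 * F * R, by positivity, by positivity,
    fun E _ _ d => ?_⟩
  have hweight : ∀ s ⊆ Finset.range (n + m),
      ∑ j ∈ s, ‖d j‖ ^ 2 ≤ R * ∑ j ∈ s, N j * ‖d j‖ ^ 2 := fun s hs => by
    rw [Finset.mul_sum]
    refine Finset.sum_le_sum fun j hj => ?_
    rw [← mul_assoc]
    exact le_mul_of_one_le_left (sq_nonneg _) (hNR j (hs hj))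
  have hupper : ∑ j ∈ Finset.range (n + m), N j * ‖d j‖ ^ 2 ≤
      M * ∑ j ∈ Finset.range (n + m), ‖d j‖ ^ 2 := by
    rw [Finset.mul_sum]
    exact Finset.sum_le_sum fun j hj => mul_le_mul_of_nonneg_right (hNM j hj) (sq_nonneg _)
  have hsplit : ∑ j ∈ Finset.range (n + m), ‖d j‖ ^ 2 =
      ∑ j ∈ Finset.range n, ‖d j‖ ^ 2 + ∑ i : Fin m, ‖d (n + (i : ℕ))‖ ^ 2 := by
    rw [Finset.sum_range_add, Finset.sum_range (n := m)]
  have hval : ∑ k : Fin m, ‖∑ j ∈ Finset.range (n + m), A k j • d j‖ ^ 2 ≤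
      F * ∑ j ∈ Finset.range (n + m), ‖d j‖ ^ 2 := sum_norm_sq_sum_smul_le _ _ _ _
  have hmono : ∑ j ∈ Finset.range n, N j * ‖d j‖ ^ 2 ≤
      ∑ j ∈ Finset.range (n + m), N j * ‖d j‖ ^ 2 :=
    Finset.sum_le_sum_of_subset_of_nonneg hsub fun j hj _ =>
      mul_nonneg (hN' j hj).le (sq_nonneg _)
  have hlow0 : 0 ≤ ∑ j ∈ Finset.range n, N j * ‖d j‖ ^ 2 :=
    Finset.sum_nonneg fun j hj => mul_nonneg (hN' j (hsub hj)).le (sq_nonneg _)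
  have hV0 : 0 ≤ ∑ k : Fin m, ‖∑ j ∈ Finset.range (n + m), A k j • d j‖ ^ 2 := by positivity
  have hlow := hweight _ hsub
  have hall := hweight _ subset_rfl
  have hh := hhigh E d
  set V := ∑ k : Fin m, ‖∑ j ∈ Finset.range (n + m), A k j • d j‖ ^ 2
  set L := ∑ j ∈ Finset.range n, N j * ‖d j‖ ^ 2
  constructor
  · refine hupper.trans ?_
    rw [mul_assoc, hsplit]
    refine mul_le_mul_of_nonneg_left ?_ hM0.le
    have h1 := mul_le_mul_of_nonneg_left hlow (by positivity : 0 ≤ 1 + K)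
    have h2 : 0 ≤ (1 + K) * R * V := by positivity
    have h3 : 0 ≤ K * L := by positivity
    have h4 : 0 ≤ K * V := by positivity
    linarith
  · have h1 := mul_le_mul_of_nonneg_left hall hF0
    linarith

/-- norm equivalence for the DGiT side-condition map `𝒥`.  If `D̃` is
invertible there are constants `C₁, C₂ > 0` depending only on `q`, `n_s`, `θ` (independent
of the interval `(a,b)`, the space `E` and its dimension, and of `v`) such that
`C₁ ‖v‖_{L²((a,b);E)} ≤ ⫴𝒥(v)⫴ ≤ C₂ ‖v‖_{L²((a,b);E)}` for all `v ∈ P_q(E)`, where `pv`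
denotes the `L²((a,b);E)`-orthogonal projection of `v` onto `P_{q-n_s}(E)`. -/
theorem dgit_side_condition_norm_equivalence
    (q ns : ℕ) (hns1 : 1 ≤ ns) (hnsq : ns ≤ q + 1)
    (θ : Fin ns → ℝ) (hθ : StrictMono θ) (hθ1 : ∀ k, θ k ≤ 1)
    (ψ : ℕ → Polynomial ℝ)
    (hψdeg : ∀ j ≤ q, (ψ j).degree = (j : ℕ))
    (hψorth : ∀ j ≤ q, ∀ k ≤ q, j ≠ k →
      ∫ t in (-1 : ℝ)..1, (ψ j).eval t * (ψ k).eval t = 0)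
    (hD : IsUnit (Matrix.of fun j k : Fin ns => (ψ (q + 1 - ns + (k : ℕ))).eval (2 * θ j - 1))) :
    ∃ C1 C2 : ℝ, 0 < C1 ∧ 0 < C2 ∧
      ∀ (E : Type) [NormedAddCommGroup E] [InnerProductSpace ℝ E]
        [FiniteDimensional ℝ E] [Nontrivial E],
        ∀ a b : ℝ, a < b →
        ∀ v : ℝ → E, memPolyZ E q (q : ℤ) v →
        ∀ pv : ℝ → E, memPolyZ E q ((q : ℤ) - ns) pv →
          (∀ w : ℝ → E, memPolyZ E q ((q : ℤ) - ns) w →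
            ∫ t in Set.Ioo a b, ⟪v t - pv t, w t⟫ = 0) →
          C1 * Real.sqrt (∫ t in Set.Ioo a b, ‖v t‖ ^ 2) ≤
            Real.sqrt ((∫ t in Set.Ioo a b, ‖pv t‖ ^ 2) +
              (b - a) * ∑ k : Fin ns, ‖v (a + θ k * (b - a))‖ ^ 2) ∧
          Real.sqrt ((∫ t in Set.Ioo a b, ‖pv t‖ ^ 2) +
              (b - a) * ∑ k : Fin ns, ‖v (a + θ k * (b - a))‖ ^ 2) ≤
            C2 * Real.sqrt (∫ t in Set.Ioo a b, ‖v t‖ ^ 2) := by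
  obtain ⟨n, hn⟩ : ∃ n, q + 1 = n + ns := ⟨q + 1 - ns, by omega⟩
  have hnq : n ≤ q + 1 := by omega
  have hsubn : q + 1 - ns = n := by omega
  have hdeg : (q : ℤ) - ns = (n : ℤ) - 1 := by omega
  rw [hsubn] at hD
  set N : ℕ → ℝ := fun j => ∫ t in (-1 : ℝ)..1, (ψ j).eval t ^ 2 with hNdef
  have hN : ∀ j ≤ q, 0 < N j := fun j hj => Polynomial.integral_eval_sq_pos fun h0 => by
    simpa [h0] using hψdeg j hj
  obtain ⟨K1, K2, hK1, hK2, hK⟩ := exists_coeff_quadratic_form_equiv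
    (fun k j => (ψ j).eval (2 * θ k - 1)) hD N fun j hj => hN j (by omega)
  refine ⟨Real.sqrt K1⁻¹, Real.sqrt K2, Real.sqrt_pos.2 (inv_pos.2 hK1), Real.sqrt_pos.2 hK2, ?_⟩
  intro E _ _ _ _ a b hab v hv pv hpv horth
  rw [hdeg] at hpv horth
  have hba : 0 < b - a := sub_pos.2 hab
  obtain ⟨d, -, hd⟩ := memPolyZ.exists_sum_eval_smul (n := q + 1) le_rfl hψdeg
    (by simpa using hv) ((b - a) / 2) ((a + b) / 2)
  obtain ⟨e, he0, he⟩ := hpv.exists_sum_eval_smul hnq hψdeg ((b - a) / 2) ((a + b) / 2)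
  have hnormsq : ∀ (f : ℝ → E) (c : ℕ → E),
      (∀ t, f ((b - a) / 2 * t + (a + b) / 2) =
        ∑ j ∈ Finset.range (q + 1), (ψ j).eval t • c j) →
      ∫ t in Set.Ioo a b, ‖f t‖ ^ 2 =
        (b - a) / 2 * ∑ j ∈ Finset.range (q + 1), N j * ‖c j‖ ^ 2 := by
    intro f c hf
    rw [integral_Ioo_eq_integral_reference hab]
    simp only [hf, ← real_inner_self_eq_norm_sq]
    rw [integral_inner_sum_eval_smul hψorth]
  have hde : ∀ j < n, e j = d j := by
    set u : ℕ → E := fun j => if j < n then d j - e j else 0 with hu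
    set w : ℝ → E := fun t => ∑ j ∈ Finset.range (q + 1),
      ((ψ j).comp (Polynomial.C (2 / (b - a)) * Polynomial.X +
        Polynomial.C (-(a + b) / (b - a)))).eval t • u j with hw
    have hwmem : memPolyZ E q ((n : ℤ) - 1) w := by
      refine memPolyZ_sum_eval_smul hnq _ _ _ fun j hj huj => ?_
      have hjn : j < n := by
        by_contra h
        exact huj (if_neg h)
      refine lt_of_le_of_lt Polynomial.degree_le_natDegree ?_
      have h1 : (ψ j).natDegree = j :=
        Polynomial.natDegree_eq_of_degree_eq_some (hψdeg j (by omega))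
      have h2 := Polynomial.natDegree_linear_le (a := 2 / (b - a)) (b := -(a + b) / (b - a))
      have h3 := Nat.mul_le_mul_left (ψ j).natDegree h2
      rw [Polynomial.natDegree_comp]
      exact_mod_cast (by omega)
    have hwt : ∀ t, w ((b - a) / 2 * t + (a + b) / 2) =
        ∑ j ∈ Finset.range (q + 1), (ψ j).eval t • u j := by
      intro t
      have harg : 2 / (b - a) * ((b - a) / 2 * t + (a + b) / 2) + -(a + b) / (b - a) = t := by
        field_simp
        ring
      simp only [hw, Polynomial.eval_comp, Polynomial.eval_add, Polynomial.eval_mul,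
        Polynomial.eval_C, Polynomial.eval_X, harg]
    have h0 := horth w hwmem
    rw [integral_Ioo_eq_integral_reference hab] at h0
    simp only [hwt, hd, he, ← Finset.sum_sub_distrib, ← smul_sub] at h0
    rw [integral_inner_sum_eval_smul hψorth] at h0
    have hu' : ∀ j, ⟪d j - e j, u j⟫ = ‖u j‖ ^ 2 := by
      intro j
      by_cases hj : j < n
      · simp [hu, hj]
      · simp [hu, hj]
    simp only [hu'] at h0
    have h0' := (mul_eq_zero.1 h0).resolve_left (half_pos hba).ne'
    rw [Finset.sum_eq_zero_iff_of_nonneg fun j hj => mul_nonneg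
      (hN j (Nat.lt_succ_iff.1 (Finset.mem_range.1 hj))).le (sq_nonneg _)] at h0'
    intro j hj
    have h1 := (mul_eq_zero.1 (h0' j (Finset.mem_range.2 (by omega)))).resolve_left
      (hN j (by omega)).ne'
    have h2 : u j = 0 := by simpa using h1
    simp only [hu, if_pos hj] at h2
    exact (sub_eq_zero.1 h2).symm
  have hpvsum : ∑ j ∈ Finset.range (q + 1), N j * ‖e j‖ ^ 2 =
      ∑ j ∈ Finset.range n, N j * ‖d j‖ ^ 2 := by
    rw [← Finset.sum_subset (Finset.range_subset_range.2 hnq)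
      fun j _ hj => by simp [he0 j (by simpa using hj)]]
    exact Finset.sum_congr rfl fun j hj => by rw [hde j (Finset.mem_range.1 hj)]
  have hvθ : ∀ k, v (a + θ k * (b - a)) =
      ∑ j ∈ Finset.range (q + 1), (ψ j).eval (2 * θ k - 1) • d j := by
    intro k
    rw [← hd]
    congr 1
    ring
  rw [hnormsq v d hd, hnormsq pv e he, hpvsum]
  simp only [hvθ]
  obtain ⟨hlower, hupper⟩ := hK E d
  rw [← hn] at hlower hupper
  rw [← Real.sqrt_mul (inv_pos.2 hK1).le, ← Real.sqrt_mul hK2.le]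
  constructor
  · refine Real.sqrt_le_sqrt ?_
    rw [inv_mul_le_iff₀ hK1]
    linarith [mul_le_mul_of_nonneg_left hlower (half_pos hba).le]
  · refine Real.sqrt_le_sqrt ?_
    linarith [mul_le_mul_of_nonneg_left hupper (half_pos hba).le]
end
end

section
/- Assume the matrix D̃ is invertible, fix reals a < b, and fix coefficients c_1, …, c_{n_s} ∈ ℝ. Suppose u ∈ P_q(E) and U ∈ E satisfy the homogeneous single-substep DGiT system: (i) u(a + θ_k (b−a)) = c_k U for every 1 ≤ k ≤ n_s, and (ii) ⟨U, v(b)⟩_E = ∫_a^b ⟨u(t), v′(t)⟩_E dt for every v ∈ P_{q+1−n_s}(E). Then u = 0 and U = 0; consequently, the single-substep DGiT linear system for (u, U) is nonsingular and admits a unique solution for arbitrary data. -/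
open MeasureTheory
open scoped RealInnerProductSpace

noncomputable section

/-- `P_m(E)` for `m : ℕ`: E-valued polynomial functions `ℝ → E` of degree at most `m`. -/
def memPoly (E : Type*) [AddCommGroup E] [Module ℝ E] (m : ℕ) (f : ℝ → E) : Prop :=
  ∃ c : Fin (m + 1) → E, ∀ t : ℝ, f t = ∑ k : Fin (m + 1), t ^ (k : ℕ) • c k

namespace Polynomial

theorem exists_eq_sum_of_degree_eq (ψ : ℕ → Polynomial ℝ) (q : ℕ)
    (hψ : ∀ j ≤ q, (ψ j).degree = (j : ℕ)) (p : Polynomial ℝ) (hp : p.degree < (q + 1 : ℕ)) :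
    ∃ α : ℕ → ℝ, p = ∑ j ∈ Finset.range (q + 1), α j • ψ j := by
  let S : Polynomial.Sequence ℝ :=
    { elems' := fun j => if j ≤ q then ψ j else X ^ j
      degree_eq' := fun j => by
        split_ifs with h
        · exact hψ j h
        · exact degree_X_pow j }
  have hmem : p ∈ Submodule.span ℝ (S '' (Finset.range (q + 1) : Set ℕ)) := by
    rw [Finset.coe_range, S.span_degreeLT
      fun i _ => (leadingCoeff_ne_zero.mpr (S.ne_zero i)).isUnit]
    exact mem_degreeLT.mpr hp
  obtain ⟨α, hα⟩ := (Submodule.mem_span_image_finset_iff_exists_fun ℝ).mp hmem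
  refine ⟨fun j => if hj : j ∈ Finset.range (q + 1) then α ⟨j, hj⟩ else 0, ?_⟩
  rw [← hα, ← Finset.sum_coe_sort (Finset.range (q + 1))]
  refine Finset.sum_congr rfl fun j _ => ?_
  have hj : (j : ℕ) ≤ q := Nat.lt_succ_iff.mp (Finset.mem_range.mp j.2)
  simp only [dif_pos j.2]
  exact congrArg (α j • ·) (if_pos hj)

theorem integral_eval_mul_self_pos {p : Polynomial ℝ} (hp : p ≠ 0) {a b : ℝ} (hab : a < b) :
    0 < ∫ t in a..b, p.eval t * p.eval t := by
  have hex : ∃ x ∈ Set.Icc a b, p.eval x ≠ 0 := by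
    by_contra! h
    exact hp (p.eq_zero_of_infinite_isRoot ((Set.Icc_infinite hab).mono h))
  obtain ⟨x, hx, hpx⟩ := hex
  exact intervalIntegral.integral_pos hab (by fun_prop) (fun t _ => mul_self_nonneg _)
    ⟨x, hx, mul_self_pos.mpr hpx⟩

theorem integral_eval_mul_eq_zero_of_pow {p : Polynomial ℝ} {a b : ℝ} {n : ℕ}
    (h : ∀ k < n, ∫ t in a..b, p.eval t * t ^ k = 0) {g : Polynomial ℝ} (hg : g.natDegree < n) :
    ∫ t in a..b, p.eval t * g.eval t = 0 := by
  simp only [eval_eq_sum_range' hg, Finset.mul_sum, mul_left_comm (p.eval _)]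
  rw [intervalIntegral.integral_finsetSum
    fun k _ => (Continuous.intervalIntegrable (by fun_prop) a b)]
  refine Finset.sum_eq_zero fun k hk => ?_
  rw [intervalIntegral.integral_const_mul, h k (Finset.mem_range.mp hk), mul_zero]

/-- A polynomial of degree at most `q` that is orthogonal to the first `q + 1 - n` members of an
orthogonal family, and vanishes at `n` nodes at which the remaining members have an invertible
collocation matrix, is zero. -/
theorem eq_zero_of_orthogonal_of_eval_eq_zero {q n : ℕ} (hn : n ≤ q + 1) (ψ : ℕ → Polynomial ℝ)
    (hψdeg : ∀ j ≤ q, (ψ j).degree = (j : ℕ))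
    (hψorth : ∀ j ≤ q, ∀ k ≤ q, j ≠ k →
      ∫ t in (-1 : ℝ)..1, (ψ j).eval t * (ψ k).eval t = 0)
    (x : Fin n → ℝ)
    (hD : IsUnit (Matrix.of fun j k : Fin n => (ψ (q + 1 - n + (k : ℕ))).eval (x j)))
    {p : Polynomial ℝ} (hp : p.degree < (q + 1 : ℕ))
    (horth : ∀ j < q + 1 - n, ∫ t in (-1 : ℝ)..1, p.eval t * (ψ j).eval t = 0)
    (hx : ∀ j, p.eval (x j) = 0) : p = 0 := by
  obtain ⟨α, rfl⟩ := exists_eq_sum_of_degree_eq ψ q hψdeg p hp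
  have hlow : ∀ j < q + 1 - n, α j = 0 := by
    intro j hj
    have hjq : j ≤ q := by lia
    have h := horth j hj
    simp only [eval_finsetSum, eval_smul, smul_eq_mul, Finset.sum_mul, mul_assoc] at h
    rw [intervalIntegral.integral_finsetSum
      fun k _ => (Continuous.intervalIntegrable (by fun_prop) _ _)] at h
    simp only [intervalIntegral.integral_const_mul] at h
    rw [Finset.sum_eq_single_of_mem j (Finset.mem_range.mpr (by lia))] at h
    · have hne : ψ j ≠ 0 := degree_ne_bot.mp (by simp [hψdeg j hjq])
      exact (mul_eq_zero.mp h).resolve_right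
        (integral_eval_mul_self_pos hne (by norm_num)).ne'
    · intro k hk hkj
      rw [hψorth k (Nat.lt_succ_iff.mp (Finset.mem_range.mp hk)) j hjq hkj, mul_zero]
  have hsplit : ∑ j ∈ Finset.range (q + 1), α j • ψ j =
      ∑ k : Fin n, α (q + 1 - n + k) • ψ (q + 1 - n + k) := by
    rw [← Nat.sub_add_cancel hn, Finset.sum_range_add, Nat.sub_add_cancel hn,
      Finset.sum_eq_zero (s := Finset.range (q + 1 - n)), zero_add, Finset.sum_range]
    intro j hj
    rw [hlow j (Finset.mem_range.mp hj), zero_smul]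
  rw [hsplit] at hx ⊢
  have hker : (Matrix.of fun j k : Fin n => (ψ (q + 1 - n + (k : ℕ))).eval (x j)).mulVec
      (fun k => α (q + 1 - n + k)) = 0 := by
    ext j
    simpa [Matrix.mulVec, dotProduct, eval_finsetSum, mul_comm] using hx j
  have hα := Matrix.mulVec_injective_of_isUnit hD (hker.trans (Matrix.mulVec_zero _).symm)
  refine Finset.sum_eq_zero fun k _ => ?_
  rw [show α (q + 1 - n + k) = 0 from congrFun hα k, zero_smul]

end Polynomial

theorem memPoly_pow_smul {E : Type*} [AddCommGroup E] [Module ℝ E] {m k : ℕ} (hk : k ≤ m) (e : E) :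
    memPoly E m fun t => t ^ k • e :=
  ⟨Pi.single ⟨k, Nat.lt_succ_of_le hk⟩ e, fun t => by
    rw [Finset.sum_eq_single_of_mem ⟨k, Nat.lt_succ_of_le hk⟩ (Finset.mem_univ _)]
    · simp
    · intro j _ hj
      simp [Pi.single_eq_of_ne hj]⟩

theorem memPolyZ.exists_eval_eq_inner {E : Type*} [NormedAddCommGroup E] [InnerProductSpace ℝ E]
    {q : ℕ} {m : ℤ} {u : ℝ → E} (hu : memPolyZ E q m u) (e : E) :
    ∃ p : Polynomial ℝ, p.degree < (q + 1 : ℕ) ∧ ∀ t, p.eval t = ⟪u t, e⟫ := by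
  obtain ⟨c, -, hc⟩ := hu
  refine ⟨∑ k : Fin (q + 1), Polynomial.C ⟪c k, e⟫ * Polynomial.X ^ (k : ℕ),
    Polynomial.degree_sum_fin_lt _, fun t => ?_⟩
  simp only [hc, Polynomial.eval_finsetSum, sum_inner, real_inner_smul_left, Polynomial.eval_mul,
    Polynomial.eval_C, Polynomial.eval_pow, Polynomial.eval_X, mul_comm]

/-- the homogeneous single-substep DGiT system has only the trivial solution:
if `u ∈ P_q(E)` and `U ∈ E` satisfy the side conditions `u(a+θ_k(b-a)) = c_k • U` and the
variational conditions `⟨U, v(b)⟩ = ∫_a^b ⟨u(t), v'(t)⟩ dt` for all `v ∈ P_{q+1-n_s}(E)`,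
then `u = 0` and `U = 0`; hence the single-substep DGiT linear system is nonsingular. -/
theorem dgit_substep_homogeneous_trivial
    (E : Type*) [NormedAddCommGroup E] [InnerProductSpace ℝ E]
    [FiniteDimensional ℝ E] [Nontrivial E]
    (q ns : ℕ) (hns1 : 1 ≤ ns) (hnsq : ns ≤ q + 1)
    (θ : Fin ns → ℝ) (hθ : StrictMono θ) (hθ1 : ∀ k, θ k ≤ 1)
    (ψ : ℕ → Polynomial ℝ)
    (hψdeg : ∀ j ≤ q, (ψ j).degree = (j : ℕ))
    (hψorth : ∀ j ≤ q, ∀ k ≤ q, j ≠ k →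
      ∫ t in (-1 : ℝ)..1, (ψ j).eval t * (ψ k).eval t = 0)
    (hD : IsUnit (Matrix.of fun j k : Fin ns => (ψ (q + 1 - ns + (k : ℕ))).eval (2 * θ j - 1)))
    (a b : ℝ) (hab : a < b)
    (c : Fin ns → ℝ)
    (u : ℝ → E) (hu : memPolyZ E q (q : ℤ) u) (U : E)
    (hside : ∀ k : Fin ns, u (a + θ k * (b - a)) = c k • U)
    (hvar : ∀ v : ℝ → E, memPoly E (q + 1 - ns) v →
      ⟪U, v b⟫ = ∫ t in Set.Ioo a b, ⟪u t, deriv v t⟫) :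
    (∀ t : ℝ, u t = 0) ∧ U = 0 := by
  have hU : U = 0 := by
    have h := hvar (fun _ => U) (by simpa using memPoly_pow_smul (Nat.zero_le _) U)
    simpa using h
  refine ⟨fun t => ?_, hU⟩
  refine ext_inner_right ℝ fun e => ?_
  obtain ⟨p, hpdeg, hp⟩ := hu.exists_eval_eq_inner e
  have hpow : ∀ k < q + 1 - ns, ∫ t in a..b, p.eval t * t ^ k = 0 := by
    intro k hk
    have h := hvar _ (memPoly_pow_smul (Nat.succ_le_of_lt hk) e)
    have hderiv : ∀ t : ℝ, deriv (fun t : ℝ => t ^ (k + 1) • e) t = ((k + 1) * t ^ k) • e := by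
      intro t
      simpa using ((hasDerivAt_pow (k + 1) t).smul_const e).deriv
    simp only [Nat.succ_eq_add_one, hderiv, real_inner_smul_right, ← hp, hU, inner_zero_left] at h
    rw [← integral_Ioc_eq_integral_Ioo, ← intervalIntegral.integral_of_le hab.le] at h
    simp only [mul_right_comm _ (_ ^ k), mul_assoc, intervalIntegral.integral_const_mul] at h
    exact (mul_eq_zero.mp h.symm).resolve_left (by positivity)
  let L : Polynomial ℝ := Polynomial.C ((b - a) / 2) * Polynomial.X + Polynomial.C ((a + b) / 2)
  have hba : b - a ≠ 0 := (sub_pos.mpr hab).ne'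
  have hscale : (b - a) / 2 ≠ 0 := div_ne_zero hba two_ne_zero
  have hLdeg : L.natDegree = 1 := Polynomial.natDegree_linear hscale
  have hcomp : p.comp L = 0 := by
    refine Polynomial.eq_zero_of_orthogonal_of_eval_eq_zero hnsq ψ hψdeg hψorth
      (fun j => 2 * θ j - 1) hD ?_ ?_ ?_
    · rcases eq_or_ne p 0 with rfl | hp0
      · simp
      · refine Polynomial.degree_le_natDegree.trans_lt (Nat.cast_lt.mpr ?_)
        rw [Polynomial.natDegree_comp, hLdeg, mul_one]
        exact (Polynomial.natDegree_lt_iff_degree_lt hp0).mpr hpdeg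
    · intro j hj
      let M : Polynomial ℝ :=
        Polynomial.C (2 / (b - a)) * Polynomial.X + Polynomial.C (-(a + b) / (b - a))
      have hMdeg : M.natDegree = 1 := Polynomial.natDegree_linear (div_ne_zero two_ne_zero hba)
      have hdeg : ((ψ j).comp M).natDegree < q + 1 - ns := by
        rw [Polynomial.natDegree_comp, hMdeg, mul_one,
          Polynomial.natDegree_eq_of_degree_eq_some (hψdeg j (by lia))]
        exact hj
      have hint := intervalIntegral.integral_comp_mul_add (a := -1) (b := 1)
        (fun t => p.eval t * ((ψ j).comp M).eval t) hscale ((a + b) / 2)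
      rw [show (b - a) / 2 * -1 + (a + b) / 2 = a by ring,
        show (b - a) / 2 * 1 + (a + b) / 2 = b by ring,
        Polynomial.integral_eval_mul_eq_zero_of_pow hpow hdeg, smul_zero] at hint
      rw [← hint]
      refine intervalIntegral.integral_congr fun s _ => ?_
      have hML : 2 / (b - a) * ((b - a) / 2 * s + (a + b) / 2) + -(a + b) / (b - a) = s := by
        field_simp
        ring
      simp only [L, M, Polynomial.eval_comp, Polynomial.eval_add, Polynomial.eval_mul,
        Polynomial.eval_C, Polynomial.eval_X, hML]
    · intro j
      have hnode : (b - a) / 2 * (2 * θ j - 1) + (a + b) / 2 = a + θ j * (b - a) := by ring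
      simp [L, hnode, hp, hside, hU]
  have hLt : L.eval ((t - (a + b) / 2) / ((b - a) / 2)) = t := by
    simp only [L, Polynomial.eval_add, Polynomial.eval_mul, Polynomial.eval_C, Polynomial.eval_X,
      mul_div_cancel₀ _ hscale, sub_add_cancel]
  rw [inner_zero_left, ← hp, ← hLt, ← Polynomial.eval_comp, hcomp, Polynomial.eval_zero]
end
end

section
/- Let E be a real inner product space, let p : ℝ → E be an E-valued polynomial function, and let a < b be reals. Then ∫_a^b ⟨ p(t), d/dt[ (b − t) p(t) ] ⟩_E dt = −(1/2) ∫_a^b ‖p(t)‖²_E dt − ((b − a)/2) ‖p(a)‖²_E. In particular, if ∫_a^b ⟨ p(t), d/dt[ (b − t) p(t) ] ⟩_E dt = 0 then p = 0. -/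
open MeasureTheory
open scoped RealInnerProductSpace

noncomputable section

theorem eq_zero_of_integral_norm_sq_eq_zero {E : Type*} [NormedAddCommGroup E]
    {p : ℝ → E} (hp : Continuous p) {a b : ℝ} (h : ∫ t in Set.Ioo a b, ‖p t‖ ^ 2 = 0) :
    Set.EqOn p 0 (Set.Ioo a b) := by
  have hc : Continuous fun t => ‖p t‖ ^ 2 := by fun_prop
  have hint : IntegrableOn (fun t => ‖p t‖ ^ 2) (Set.Ioo a b) :=
    (hc.integrableOn_Icc (a := a) (b := b)).mono_set Set.Ioo_subset_Icc_self
  have hae := (integral_eq_zero_iff_of_nonneg (fun t => by positivity) hint).1 h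
  have heq := Measure.eqOn_open_of_ae_eq hae isOpen_Ioo hc.continuousOn continuousOn_const
  intro t ht
  simpa using heq ht

theorem integral_inner_deriv_sub_smul {E : Type*} [NormedAddCommGroup E] [InnerProductSpace ℝ E]
    {p : ℝ → E} (hp : ContDiff ℝ 1 p) {a b : ℝ} (hab : a ≤ b) :
    (∫ t in Set.Ioo a b, ⟪p t, deriv (fun s => (b - s) • p s) t⟫) =
      -(1 / 2) * (∫ t in Set.Ioo a b, ‖p t‖ ^ 2) - ((b - a) / 2) * ‖p a‖ ^ 2 := by
  have hc : Continuous p := hp.continuous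
  have hc' : Continuous (deriv p) := hp.continuous_deriv le_rfl
  have hd (t : ℝ) : HasDerivAt p (deriv p t) t :=
    (hp.differentiable one_ne_zero t).hasDerivAt
  have hb (t : ℝ) : HasDerivAt (fun s : ℝ => b - s) (-1) t := by
    simpa using (hasDerivAt_id t).const_sub b
  have hF (t : ℝ) : HasDerivAt (fun s => (b - s) * ‖p s‖ ^ 2 / 2)
      (-(1 / 2) * ‖p t‖ ^ 2 + (b - t) * ⟪p t, deriv p t⟫) t := by
    refine (((hb t).mul (hd t).norm_sq).div_const 2).congr_deriv ?_
    ring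
  have hcF : Continuous fun t => -(1 / 2) * ‖p t‖ ^ 2 + (b - t) * ⟪p t, deriv p t⟫ := by
    fun_prop
  have hcN : Continuous fun t => -(1 / 2) * ‖p t‖ ^ 2 := by fun_prop
  have hftc := intervalIntegral.integral_eq_sub_of_hasDerivAt (fun t _ => hF t)
    (hcF.intervalIntegrable a b)
  have hderiv (t : ℝ) : ⟪p t, deriv (fun s => (b - s) • p s) t⟫ =
      -(1 / 2) * ‖p t‖ ^ 2 + (-(1 / 2) * ‖p t‖ ^ 2 + (b - t) * ⟪p t, deriv p t⟫) := by
    have h : deriv (fun s => (b - s) • p s) t = (b - t) • deriv p t + (-1 : ℝ) • p t :=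
      ((hb t).smul (hd t)).deriv
    rw [h, inner_add_right, inner_smul_right, inner_smul_right, real_inner_self_eq_norm_sq]
    ring
  simp_rw [hderiv, ← integral_Ioc_eq_integral_Ioo, ← intervalIntegral.integral_of_le hab]
  rw [intervalIntegral.integral_add (hcN.intervalIntegrable a b) (hcF.intervalIntegrable a b),
    hftc, intervalIntegral.integral_const_mul]
  ring

/-- for a polynomial function `p : ℝ → E` into a real inner product space and
reals `a < b`, `∫_a^b ⟨p(t), d/dt[(b-t)p(t)]⟩ dt = -(1/2)∫_a^b ‖p(t)‖² dt - ((b-a)/2)‖p(a)‖²`;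
in particular, if the left-hand side vanishes then `p = 0`. -/
theorem poly_energy_identity
    (E : Type*) [NormedAddCommGroup E] [InnerProductSpace ℝ E]
    (p : ℝ → E)
    (hp : ∃ n : ℕ, ∃ c : Fin n → E, ∀ t : ℝ, p t = ∑ k : Fin n, t ^ (k : ℕ) • c k)
    (a b : ℝ) (hab : a < b) :
    (∫ t in Set.Ioo a b, ⟪p t, deriv (fun s => (b - s) • p s) t⟫) =
      -(1 / 2) * (∫ t in Set.Ioo a b, ‖p t‖ ^ 2) - ((b - a) / 2) * ‖p a‖ ^ 2 ∧
    ((∫ t in Set.Ioo a b, ⟪p t, deriv (fun s => (b - s) • p s) t⟫) = 0 →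
      ∀ t : ℝ, p t = 0) := by
  obtain ⟨n, c, hpc⟩ := hp
  have han : AnalyticOnNhd ℝ p Set.univ := by
    rw [funext hpc]
    intro t _
    fun_prop
  have hcd : ContDiff ℝ 1 p := by
    rw [funext hpc]
    fun_prop
  have hid := integral_inner_deriv_sub_smul hcd hab.le
  refine ⟨hid, fun h0 t => ?_⟩
  have hN : 0 ≤ ∫ t in Set.Ioo a b, ‖p t‖ ^ 2 := integral_nonneg fun t => by positivity
  have hA : 0 ≤ (b - a) / 2 * ‖p a‖ ^ 2 :=
    mul_nonneg (by linarith) (sq_nonneg _)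
  have hzero := eq_zero_of_integral_norm_sq_eq_zero hcd.continuous
    (show ∫ t in Set.Ioo a b, ‖p t‖ ^ 2 = 0 by linarith)
  obtain ⟨m, hm⟩ := Set.nonempty_Ioo.2 hab
  have hev : ∀ᶠ s in nhds m, p s = 0 :=
    Filter.eventually_of_mem (isOpen_Ioo.mem_nhds hm) hzero
  exact han.eqOn_zero_of_preconnected_of_frequently_eq_zero isPreconnected_univ
    (Set.mem_univ m) (hev.filter_mono nhdsWithin_le_nhds).frequently (Set.mem_univ t)
end
end

section
/- Let {A_ñ} and {B_ñ}, 0 ≤ ñ ≤ N, be sequences of non-negative real numbers, let C_1, C_2, Δt be positive constants, and let N_0 ∈ ℕ with 1 ≤ N_0 ≤ N. Suppose that A_ñ ≤ A_{ñ−1} + C_1 Δt Σ_{k=1}^{N_0} A_{ñ−k} + C_2 √Δt · B_ñ for every ñ with N_0 ≤ ñ ≤ N. Then, with à := max{A_0, …, A_{N_0 − 1}}, for every ñ with N_0 ≤ ñ ≤ N one has A_ñ ≤ Ã (1 + N_0 C_1 Δt)^{ñ + 1 − N_0} + C_2 √Δt Σ_{k=N_0}^{ñ} B_k (1 + N_0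 C_1 Δt)^{ñ − k}. -/
/-- If `A` satisfies a recursive inequality with `p + 1` delays and `U` satisfies the associated
one-step recursion and dominates the initial values, then `U m` dominates all `A j`, `j ≤ m`. -/
theorem le_majorant_of_delay_recursion {N p : ℕ} {A b U : ℕ → ℝ} {c : ℝ} (hc : 0 ≤ c)
    (hA : 0 ≤ A 0) (hb : ∀ n ≤ N, 0 ≤ b n)
    (hrec : ∀ m, p ≤ m → m + 1 ≤ N →
      A (m + 1) ≤ A m + c * (∑ k ∈ Finset.Icc 1 (p + 1), A (m + 1 - k)) + b (m + 1))
    (hinit : ∀ j ≤ p, A j ≤ U p)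
    (hU : ∀ m, p ≤ m → U (m + 1) = (1 + ((p + 1 : ℕ) : ℝ) * c) * U m + b (m + 1))
    {m : ℕ} (hm : p ≤ m) (hmN : m ≤ N) : ∀ j ≤ m, A j ≤ U m := by
  induction m, hm using Nat.le_induction with
  | base => exact hinit
  | succ m hm ih =>
    have hle := ih (by omega)
    have hU0 : 0 ≤ U m := hA.trans (hle 0 (Nat.zero_le m))
    have hb0 := hb (m + 1) hmN
    intro j hj
    rw [hU m hm]
    rcases Nat.le_succ_iff.mp hj with hj | rfl
    · have : 0 ≤ ((p + 1 : ℕ) : ℝ) * c * U m := by positivity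
      linarith [hle j hj]
    · have hsum : ∑ k ∈ Finset.Icc 1 (p + 1), A (m + 1 - k) ≤ ((p + 1 : ℕ) : ℝ) * U m := by
        have h := Finset.sum_le_card_nsmul (Finset.Icc 1 (p + 1)) (fun k => A (m + 1 - k)) (U m)
          fun k hk => hle _ (by have := Finset.mem_Icc.mp hk; omega)
        simpa only [Nat.card_Icc, Nat.add_sub_cancel, nsmul_eq_mul] using h
      linarith [hrec m hm hmN, hle m le_rfl, mul_le_mul_of_nonneg_left hsum hc]

/-- One-step recursion for discrete geometric convolution sums. -/
theorem sum_Icc_mul_pow_succ {a n : ℕ} (h : a ≤ n + 1) (B : ℕ → ℝ) (q : ℝ) :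
    ∑ k ∈ Finset.Icc a (n + 1), B k * q ^ (n + 1 - k) =
      q * ∑ k ∈ Finset.Icc a n, B k * q ^ (n - k) + B (n + 1) := by
  rw [Finset.sum_Icc_succ_top h, Finset.mul_sum, Nat.sub_self, pow_zero, mul_one]
  congr 1
  refine Finset.sum_congr rfl fun k hk => ?_
  rw [Nat.succ_sub (Finset.mem_Icc.mp hk).2, pow_succ]
  ring

/-- discrete Gronwall-type sequence bound, Lemma `sequence` of the paper:
if `A_ñ ≤ A_{ñ-1} + C₁Δt Σ_{k=1}^{N₀} A_{ñ-k} + C₂√Δt B_ñ` for `N₀ ≤ ñ ≤ N`, then with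
`Ã = max{A_0, …, A_{N₀-1}}`,
`A_ñ ≤ Ã(1+N₀C₁Δt)^{ñ+1-N₀} + C₂√Δt Σ_{k=N₀}^{ñ} B_k (1+N₀C₁Δt)^{ñ-k}`. -/
theorem sequence_bound
    (N N0 : ℕ) (hN0 : 1 ≤ N0) (hN0N : N0 ≤ N)
    (A B : ℕ → ℝ)
    (hA : ∀ n ≤ N, 0 ≤ A n) (hB : ∀ n ≤ N, 0 ≤ B n)
    (C1 C2 Δt : ℝ) (hC1 : 0 < C1) (hC2 : 0 < C2) (hΔt : 0 < Δt)
    (hrec : ∀ n, N0 ≤ n → n ≤ N →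
      A n ≤ A (n - 1) + C1 * Δt * (∑ k ∈ Finset.Icc 1 N0, A (n - k)) +
        C2 * Real.sqrt Δt * B n)
    (Atil : ℝ) (hAtil : IsGreatest {x : ℝ | ∃ k < N0, x = A k} Atil) :
    ∀ n, N0 ≤ n → n ≤ N →
      A n ≤ Atil * (1 + (N0 : ℝ) * C1 * Δt) ^ (n + 1 - N0) +
        C2 * Real.sqrt Δt *
          ∑ k ∈ Finset.Icc N0 n, B k * (1 + (N0 : ℝ) * C1 * Δt) ^ (n - k) := by
  obtain ⟨p, rfl⟩ := Nat.exists_eq_add_of_le' hN0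
  intro n hn hnN
  refine le_majorant_of_delay_recursion (N := N) (p := p) (c := C1 * Δt)
    (b := fun n => C2 * Real.sqrt Δt * B n)
    (U := fun n => Atil * (1 + ((p + 1 : ℕ) : ℝ) * C1 * Δt) ^ (n + 1 - (p + 1)) +
      C2 * Real.sqrt Δt *
        ∑ k ∈ Finset.Icc (p + 1) n, B k * (1 + ((p + 1 : ℕ) : ℝ) * C1 * Δt) ^ (n - k))
    (by positivity) (hA 0 (Nat.zero_le N))
    (fun n hn => mul_nonneg (by positivity) (hB n hn))
    (fun m hm hmN => hrec (m + 1) (by omega) hmN) ?_ ?_ (by omega) hnN n le_rfl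
  · intro j hj
    simpa using hAtil.2 ⟨j, Nat.lt_succ_of_le hj, rfl⟩
  · intro m hm
    rw [sum_Icc_mul_pow_succ (by omega), show m + 1 + 1 - (p + 1) = m + 1 - (p + 1) + 1 by omega,
      pow_succ]
    ring
end
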